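/- arXiv:2010.16319 — 4 statements merged into one kernel-verified Lean document; each statement's English description precedes it below -/
import Mathlib

section
/- Let (W, S) be a Coxeter system with W a finite group and S finite. Then Σ_{J ⊆ S} (-1)^{|J|} Ind_{W_J}^W(1_{W_J}) = ε, the sign character of W; explicitly, for every w ∈ W, Σ_{J ⊆ S} (-1)^{|J|} · |W_J|^{-1} · |{x ∈ W : x^{-1} w x ∈ W_J}| = (-1)^{ℓ(w)}, where ℓ is the length function. (This is the finite Coxeter group form of the Steinberg character identity: the alternating sum of inductions of the trivial character over standard parabolic subgroups equals the sign character, the prototype of the paper's Theorem 4.1 and Remark 4.2 that St^G_{(M,σ)} corresponds to the sign character ξ of the R-group.) -/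
open scoped Classical

namespace SteinAux

section
variable {B : Type*} {W : Type*} [Group W] {M : CoxeterMatrix B} (cs : CoxeterSystem M W)

/-- generator action -/
noncomputable def fgen (i : B) : Function.End (W × ZMod 2) :=
  fun p => (cs.simple i * p.1 * cs.simple i, p.2 + if p.1 = cs.simple i then 1 else 0)

theorem pow_fgen (i j : B) (m : ℕ) (t : W) (z : ZMod 2) :
    ((fgen cs i * fgen cs j) ^ m) (t, z) =
      ((cs.simple i * cs.simple j) ^ m * t * ((cs.simple i * cs.simple j) ^ m)⁻¹,
        z + ∑ k ∈ Finset.range (2 * m),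
          if t = ((cs.simple i * cs.simple j) ^ k)⁻¹ * cs.simple j then 1 else 0) := by
  induction m with
  | zero => simp; rfl
  | succ m ih =>
    have hsi := cs.simple_mul_simple_self i
    have hsj := cs.simple_mul_simple_self j
    have hii := cs.inv_simple i
    have hij := cs.inv_simple j
    set c := cs.simple i * cs.simple j with hc
    have hci : c⁻¹ = cs.simple j * cs.simple i := by rw [hc]; simp
    have hjc : ∀ k : ℕ, cs.simple j * c ^ k = (c ^ k)⁻¹ * cs.simple j := by
      intro k
      have h1 : cs.simple j * c * (cs.simple j)⁻¹ = c⁻¹ := by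
        rw [hci, hij, hc, mul_assoc, mul_assoc, hsj, mul_one]
      have h2 := congrArg (· ^ k) h1
      simp only [conj_pow] at h2
      rw [inv_pow] at h2
      rw [← h2]; group
    rw [pow_succ']
    change (fgen cs i * fgen cs j) (((fgen cs i * fgen cs j) ^ m) (t, z)) = _
    rw [ih]
    change fgen cs i (fgen cs j _) = _
    simp only [fgen]
    have e1 : (c ^ m * t * (c ^ m)⁻¹ = cs.simple j) ↔ t = (c ^ (2 * m))⁻¹ * cs.simple j := by
      rw [two_mul, pow_add, mul_inv_rev, mul_assoc (c ^ m)⁻¹, ← hjc m]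
      constructor
      · intro h; rw [← h]; group
      · rintro rfl; group
    have e2 : (cs.simple j * (c ^ m * t * (c ^ m)⁻¹) * cs.simple j = cs.simple i) ↔
        t = (c ^ (2 * m + 1))⁻¹ * cs.simple j := by
      have e : (c ^ (2 * m + 1))⁻¹ * cs.simple j =
          (c ^ m)⁻¹ * (c⁻¹ * cs.simple j) * (c ^ m) := by
        rw [mul_assoc, mul_assoc, hjc m]; group
      rw [e, hci]
      constructor
      · intro h; rw [← h]
        have : cs.simple j * (cs.simple j * (c ^ m * t * (c ^ m)⁻¹) * cs.simple j) * cs.simple j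
          = (cs.simple j * cs.simple j) * (c ^ m * t * (c ^ m)⁻¹) * (cs.simple j * cs.simple j) := by
          group
        rw [this, hsj]; group
      · rintro rfl
        have : cs.simple j * (c ^ m * ((c ^ m)⁻¹ * (cs.simple j * cs.simple i * cs.simple j) * c ^ m) * (c ^ m)⁻¹) * cs.simple j
          = (cs.simple j * cs.simple j) * cs.simple i * (cs.simple j * cs.simple j) := by
          group
        rw [this, hsj]; group
    rw [Prod.mk.injEq]
    constructor
    · rw [pow_succ', mul_inv_rev, hci, hc]; group
    · rw [show 2 * (m + 1) = 2 * m + 1 + 1 by ring, Finset.sum_range_succ, Finset.sum_range_succ]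
      simp only [e1, e2, add_assoc]

theorem liftable : M.IsLiftable (fgen cs) := by
  intro i j
  funext ⟨t, z⟩
  rw [pow_fgen, cs.simple_mul_simple_pow, two_mul, Finset.sum_range_add]
  have : ∀ k, (cs.simple i * cs.simple j) ^ (M i j + k) = (cs.simple i * cs.simple j) ^ k := by
    intro k; rw [pow_add, cs.simple_mul_simple_pow, one_mul]
  simp only [this, CharTwo.add_self_eq_zero]
  simp; rfl

/-- the reflection representation -/
noncomputable def eta : W →* Function.End (W × ZMod 2) := cs.lift ⟨fgen cs, liftable cs⟩

theorem eta_word (ω : List B) (t : W) (z : ZMod 2) :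
    eta cs (cs.wordProd ω) (t, z) =
      (cs.wordProd ω * t * (cs.wordProd ω)⁻¹, z + ((cs.rightInvSeq ω).count t : ZMod 2)) := by
  induction ω with
  | nil => simp; rfl
  | cons i ω ih =>
    rw [cs.wordProd_cons, map_mul]
    change eta cs (cs.simple i) (eta cs (cs.wordProd ω) (t, z)) = _
    rw [ih, eta, cs.lift_apply_simple]
    simp only [fgen, CoxeterSystem.rightInvSeq, List.count_cons]
    have : (cs.wordProd ω * t * (cs.wordProd ω)⁻¹ = cs.simple i) ↔
      ((cs.wordProd ω)⁻¹ * cs.simple i * cs.wordProd ω = t) := by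
      constructor
      · intro h; rw [← h]; group
      · rintro rfl; group
    simp only [this, beq_iff_eq]
    rw [Prod.mk.injEq]
    constructor
    · simp [mul_assoc]
    · push_cast; rw [add_assoc]

/-- deletion of one letter -/
def Er (ω : List B) (x : W) : Prop :=
  ∃ l₁ b l₂, ω = l₁ ++ b :: l₂ ∧ x = cs.wordProd (l₁ ++ l₂)

theorem er_of_mem (ω : List B) (t : W) (h : t ∈ cs.rightInvSeq ω) :
    Er cs ω (cs.wordProd ω * t) := by
  obtain ⟨j, hj, rfl⟩ := List.getElem_of_mem h
  have := cs.wordProd_mul_getD_rightInvSeq ω j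
  rw [List.getD_eq_getElem _ _ hj] at this
  rw [this]
  have hj' : j < ω.length := by simpa using hj
  refine ⟨ω.take j, ω[j], ω.drop (j+1), by simp, by rw [List.eraseIdx_eq_take_drop_succ]⟩

theorem exchange (ω : List B) (i : B) (h : cs.IsRightDescent (cs.wordProd ω) i) :
    Er cs ω (cs.wordProd ω * cs.simple i) := by
  apply er_of_mem
  obtain ⟨ω', hr, hω'⟩ := cs.exists_isReduced (cs.wordProd ω * cs.simple i)
  have h1 : cs.simple i ∉ cs.rightInvSeq ω' := by
    intro hm
    have := (cs.isRightInversion_of_mem_rightInvSeq hr hm).2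
    rw [← hω'] at this
    simp only [CoxeterSystem.IsRightDescent] at h
    simp at this
    omega
  have h2 : cs.wordProd ω = cs.wordProd ω' * cs.simple i := by rw [← hω']; simp
  have h3 := eta_word cs ω (cs.simple i) 0
  rw [h2, map_mul] at h3
  change eta cs (cs.wordProd ω') (eta cs (cs.simple i) _) = _ at h3
  nth_rw 2 [eta] at h3
  rw [cs.lift_apply_simple] at h3
  simp only [fgen] at h3
  rw [cs.simple_mul_simple_self, one_mul, eta_word, List.count_eq_zero_of_not_mem h1] at h3
  by_contra hn
  rw [List.count_eq_zero_of_not_mem hn] at h3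
  simp at h3

theorem er_reverse (ω : List B) (x : W) (h : Er cs ω.reverse x) : Er cs ω x⁻¹ := by
  obtain ⟨l₁, b, l₂, h1, h2⟩ := h
  refine ⟨l₂.reverse, b, l₁.reverse, ?_, ?_⟩
  · rw [← List.reverse_reverse ω, h1]; simp
  · rw [h2, ← cs.wordProd_reverse]; simp

theorem exchange_left (ω : List B) (i : B) (h : cs.IsLeftDescent (cs.wordProd ω) i) :
    Er cs ω (cs.simple i * cs.wordProd ω) := by
  rw [← cs.isRightDescent_inv_iff, ← cs.wordProd_reverse] at h
  have := er_reverse cs _ _ (exchange cs _ _ h)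
  simpa using this

theorem er_append (ω₁ ω₂ : List B) (x : W) (h : Er cs (ω₁ ++ ω₂) x) :
    (∃ y, Er cs ω₁ y ∧ x = y * cs.wordProd ω₂) ∨ (∃ y, Er cs ω₂ y ∧ x = cs.wordProd ω₁ * y) := by
  obtain ⟨l₁, b, l₂, h1, rfl⟩ := h
  rw [List.append_eq_append_iff] at h1
  rcases h1 with ⟨a, rfl, h⟩ | ⟨a, rfl, h⟩
  · right
    exact ⟨_, ⟨a, b, l₂, h, rfl⟩, by simp [cs.wordProd_append, mul_assoc]⟩
  · rcases a with _ | ⟨c, a⟩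
    · right
      simp at h
      exact ⟨_, ⟨[], b, l₂, h.symm, rfl⟩, by simp [cs.wordProd_append]⟩
    · left
      simp at h
      obtain ⟨rfl, rfl⟩ := h
      exact ⟨_, ⟨l₁, b, a, rfl, rfl⟩, by simp [cs.wordProd_append, mul_assoc]⟩

theorem er_word (J : Set B) (ω : List B) (hω : ∀ b ∈ ω, b ∈ J) (x : W) (h : Er cs ω x) :
    ∃ ω' : List B, (∀ b ∈ ω', b ∈ J) ∧ x = cs.wordProd ω' ∧ ω'.length + 1 = ω.length := by
  obtain ⟨l₁, b, l₂, rfl, rfl⟩ := h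
  refine ⟨l₁ ++ l₂, ?_, rfl, by simp; omega⟩
  intro c hc
  apply hω
  simp at hc ⊢
  tauto

theorem word_of_mem (J : Set B) (x : W) (hx : x ∈ Subgroup.closure (cs.simple '' J)) :
    ∃ ω : List B, (∀ b ∈ ω, b ∈ J) ∧ x = cs.wordProd ω := by
  induction hx using Subgroup.closure_induction with
  | mem x hx => obtain ⟨j, hj, rfl⟩ := hx; exact ⟨[j], by simpa using hj, by simp⟩
  | one => exact ⟨[], by simp, by simp⟩
  | mul x y _ _ h1 h2 =>
    obtain ⟨a, ha, rfl⟩ := h1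
    obtain ⟨b, hb, rfl⟩ := h2
    refine ⟨a ++ b, ?_, by rw [cs.wordProd_append]⟩
    intro c hc; rw [List.mem_append] at hc; rcases hc with h | h
    · exact ha c h
    · exact hb c h
  | inv x _ h1 =>
    obtain ⟨a, ha, rfl⟩ := h1
    exact ⟨a.reverse, by simpa using ha, by simp⟩

theorem mem_of_word (J : Set B) (ω : List B) (h : ∀ b ∈ ω, b ∈ J) :
    cs.wordProd ω ∈ Subgroup.closure (cs.simple '' J) := by
  induction ω with
  | nil => simp
  | cons a ω ih =>
    rw [cs.wordProd_cons]
    exact mul_mem (Subgroup.subset_closure ⟨a, h a (by simp), rfl⟩)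
      (ih fun b hb => h b (by simp [hb]))

/-- no descents in K (left) and J (right) -/
def IsMin (K J : Set B) (d : W) : Prop :=
  (∀ i ∈ K, ¬ cs.IsLeftDescent d i) ∧ (∀ j ∈ J, ¬ cs.IsRightDescent d j)

theorem min_unique_aux (K J : Set B) (d d' : W)
    (hd : ∀ a b : List B, (∀ x ∈ a, x ∈ K) → (∀ x ∈ b, x ∈ J) →
      cs.length d ≤ cs.length (cs.wordProd a * d * cs.wordProd b))
    (hd' : IsMin cs K J d') :
    ∀ (n : ℕ) (a b : List B), (∀ x ∈ a, x ∈ K) → (∀ x ∈ b, x ∈ J) → a.length + b.length = n →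
      d' = cs.wordProd a * d * cs.wordProd b → d' = d := by
  obtain ⟨ω, hω, hdω⟩ := cs.exists_isReduced d
  have key : ∀ y, Er cs ω y → ∀ a b : List B, (∀ x ∈ a, x ∈ K) → (∀ x ∈ b, x ∈ J) →
      ∀ a' b' : List B, (∀ x ∈ a', x ∈ K) → (∀ x ∈ b', x ∈ J) →
      cs.wordProd a * d * cs.wordProd b = cs.wordProd a' * y * cs.wordProd b' → False := by
    intro y hy a b ha hb a' b' ha' hb' h
    obtain ⟨ω', -, rfl, hl⟩ := er_word cs Set.univ ω (by simp) y hy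
    have h1 : cs.wordProd ω' =
        cs.wordProd (a'.reverse ++ a) * d * cs.wordProd (b ++ b'.reverse) := by
      have : cs.wordProd ω' = (cs.wordProd a')⁻¹ * (cs.wordProd a' * cs.wordProd ω' * cs.wordProd b')
        * (cs.wordProd b')⁻¹ := by group
      rw [this, ← h]
      simp only [cs.wordProd_append, cs.wordProd_reverse]; group
    have h2 := hd (a'.reverse ++ a) (b ++ b'.reverse)
      (by intro x hx; simp at hx; rcases hx with h | h; exacts [ha' x h, ha x h])
      (by intro x hx; simp at hx; rcases hx with h | h; exacts [hb x h, hb' x h])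
    rw [← h1] at h2
    have h3 := cs.length_wordProd_le ω'
    have h4 : cs.length d = ω.length := by rw [hdω]; exact hω
    omega
  intro n
  induction n using Nat.strong_induction_on with
  | _ n ih =>
  intro a b ha hb hn h
  rcases List.eq_nil_or_concat b with rfl | ⟨b, j, rfl⟩
  · rcases a with _ | ⟨i, a⟩
    · simpa using h
    · have ha2 : ∀ x ∈ a, x ∈ K := fun x hx => ha x (by simp [hx])
      have hds : cs.wordProd (a ++ ω) = cs.simple i * d' := by
        rw [h, cs.wordProd_append, cs.wordProd_cons, ← hdω]; simp [mul_assoc]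
      have h1 := hd'.1 i (ha i (by simp))
      have h2 : cs.IsLeftDescent (cs.wordProd (a ++ ω)) i := by
        rw [hds, cs.isLeftDescent_iff_not_isLeftDescent_mul]; simpa using h1
      have h3 := exchange_left cs _ _ h2
      rw [hds, cs.simple_mul_simple_cancel_left] at h3
      rcases er_append cs _ _ _ h3 with ⟨y, hy, e⟩ | ⟨y, hy, e⟩
      · obtain ⟨a', ha', rfl, hl⟩ := er_word cs K a ha2 y hy
        exact ih (a'.length) (by simp at hn; omega) a' [] ha' (by simp) (by simp)
          (by rw [e, hdω]; simp)
      · exact (key y hy (i :: a) [] ha (by simp) a [] ha2 (by simp)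
          (by rw [← h, e]; simp)).elim
  · rw [List.concat_eq_append] at *
    have hb2 : ∀ x ∈ b, x ∈ J := fun x hx => hb x (by simp [hx])
    have hds : cs.wordProd (a ++ (ω ++ b)) = d' * cs.simple j := by
      rw [h, cs.wordProd_append, cs.wordProd_append, cs.wordProd_append, ← hdω]; simp [mul_assoc]
    have h1 := hd'.2 j (hb j (by simp))
    have h2 : cs.IsRightDescent (cs.wordProd (a ++ (ω ++ b))) j := by
      rw [hds, cs.isRightDescent_iff_not_isRightDescent_mul]; simpa using h1
    have h3 := exchange cs _ _ h2
    rw [hds, cs.simple_mul_simple_cancel_right] at h3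
    rcases er_append cs _ _ _ h3 with ⟨y, hy, e⟩ | ⟨y, hy, e⟩
    · obtain ⟨a', ha', rfl, hl⟩ := er_word cs K a ha y hy
      exact ih (a'.length + b.length) (by simp at hn; omega) a' b ha' hb2 rfl
        (by rw [e, hdω, cs.wordProd_append, mul_assoc])
    · rcases er_append cs _ _ _ hy with ⟨z, hz, e'⟩ | ⟨z, hz, e'⟩
      · exact (key z hz a (b ++ [j]) ha hb a b ha hb2
          (by rw [← h, e, e', mul_assoc])).elim
      · obtain ⟨b', hb', rfl, hl⟩ := er_word cs J b hb2 z hz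
        exact ih (a.length + b'.length) (by simp at hn; omega) a b' ha hb' rfl
          (by rw [e, e', hdω, mul_assoc])

theorem top_factor (u : W) (hu : ∀ i, cs.IsRightDescent u i) (ω : List B) :
    cs.IsReduced ω → ∃ α : List B, u = cs.wordProd (α ++ ω) ∧ cs.length u = α.length + ω.length := by
  induction ω using List.reverseRecOn with
  | nil =>
    intro _
    obtain ⟨α, h1, h2⟩ := cs.exists_isReduced u
    exact ⟨α, by simpa using h2, by rw [h2, h1.eq]; simp⟩
  | append_singleton ω i ih =>
    intro hr
    have hr' : cs.IsReduced ω := by simpa using hr.take ω.length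
    obtain ⟨α, h1, h2⟩ := ih hr'
    have h3 := hu i
    rw [h1] at h3
    have h4 := exchange cs _ _ h3
    rcases er_append cs _ _ _ h4 with ⟨y, hy, e⟩ | ⟨y, hy, e⟩
    · obtain ⟨a', -, rfl, hl⟩ := er_word cs Set.univ α (by simp) y hy
      refine ⟨a', ?_, by simp; omega⟩
      rw [← List.append_assoc, cs.wordProd_append, cs.wordProd_append, ← e, h1]; simp
    · obtain ⟨a', -, rfl, hl⟩ := er_word cs Set.univ ω (by simp) y hy
      rw [cs.wordProd_append, mul_assoc] at e
      have e := mul_left_cancel e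
      have h5 := hr.eq
      rw [cs.wordProd_append, cs.wordProd_singleton, e] at h5
      have := cs.length_wordProd_le a'
      simp at h5
      omega

theorem top_unique (u v : W) (hu : ∀ i, cs.IsRightDescent u i)
    (hv : ∀ i, cs.IsRightDescent v i) : u = v := by
  obtain ⟨a, ha, ha'⟩ := cs.exists_isReduced u
  obtain ⟨b, hb, hb'⟩ := cs.exists_isReduced v
  obtain ⟨α, h1, h2⟩ := top_factor cs u hu b hb
  obtain ⟨β, h3, h4⟩ := top_factor cs v hv a ha
  have e1 := ha.eq
  have e2 := hb.eq
  rw [← ha'] at e1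
  rw [← hb'] at e2
  have : α = [] := List.length_eq_zero_iff.mp (by omega)
  rw [h1, this, hb']; simp

theorem exists_top [Finite W] : ∃ u : W, (∀ i, cs.IsRightDescent u i) ∧
    (∀ i, cs.IsLeftDescent u i) := by
  obtain ⟨u, hu⟩ := Finite.exists_max cs.length
  refine ⟨u, fun i => ?_, fun i => ?_⟩
  · exact lt_of_le_of_ne (hu _) (cs.length_mul_simple_ne u i)
  · exact lt_of_le_of_ne (hu _) (cs.length_simple_mul_ne u i)


end

section
variable {W : Type*} [Group W] [Fintype W]

/-- induced trivial character -/
noncomputable def ff (H : Subgroup W) (w : W) : ℚ :=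
  (Nat.card H : ℚ)⁻¹ * (Nat.card {x : W // x⁻¹ * w * x ∈ H} : ℚ)

theorem card_eq (P : W → Prop) : (Nat.card {x : W // P x} : ℚ) = ∑ x, if P x then 1 else 0 := by
  rw [Nat.card_eq_fintype_card, Fintype.card_subtype]
  simp

theorem ff_eq (H : Subgroup W) (w : W) :
    ff H w = (Nat.card H : ℚ)⁻¹ * ∑ x : W, if x⁻¹ * w * x ∈ H then 1 else 0 := by
  unfold ff
  rw [card_eq (fun x => x⁻¹ * w * x ∈ H)]

theorem ff_conj (H : Subgroup W) (x w : W) : ff H (x * w * x⁻¹) = ff H w := by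
  unfold ff
  congr 2
  apply Nat.card_congr
  refine (Equiv.mulLeft x⁻¹).subtypeEquiv ?_
  intro a
  simp [mul_assoc]

theorem frob (H : Subgroup W) (g : W → ℚ) (hg : ∀ x w, g (x * w * x⁻¹) = g w) :
    ∑ w, ff H w * g w =
      Fintype.card W * ((Nat.card H : ℚ)⁻¹ * ∑ w, if w ∈ H then g w else 0) := by
  have h1 : ∀ x : W, (∑ w, if x⁻¹ * w * x ∈ H then g w else 0) = ∑ w, if w ∈ H then g w else 0 := by
    intro x
    refine Fintype.sum_equiv (MulAut.conj x⁻¹).toEquiv _ _ ?_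
    intro w
    have := hg x⁻¹ w
    simp at this
    simp [this]
  simp only [ff_eq]
  calc _ = (Nat.card H : ℚ)⁻¹ * ∑ w, ∑ x : W, if x⁻¹ * w * x ∈ H then g w else 0 := by
        rw [Finset.mul_sum]
        refine Finset.sum_congr rfl fun w _ => ?_
        rw [mul_assoc, Finset.sum_mul]
        simp
    _ = _ := by
        rw [Finset.sum_comm]
        simp only [h1]
        simp
        ring

/-- two-sided action -/
@[reducible] def dact (H K : Subgroup W) : MulAction (H × K) W where
  smul p x := p.1 * x * (p.2 : W)⁻¹
  one_smul x := by change (1 : W) * x * (1 : W)⁻¹ = x; simp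
  mul_smul p q x := by
    change ((p.1 * q.1 : H) : W) * x * ((p.2 * q.2 : K) : W)⁻¹ =
      p.1 * (q.1 * x * (q.2 : W)⁻¹) * (p.2 : W)⁻¹
    simp [mul_assoc]

/-- orbit set -/
abbrev dorb (H K : Subgroup W) : Type _ := Quotient (@MulAction.orbitRel (H × K) W _ (dact H K))

theorem burn (H K : Subgroup W) :
    (∑ u, if u ∈ H then (Nat.card {x : W // x⁻¹ * u * x ∈ K} : ℚ) else 0) =
      Nat.card (dorb H K) * (Nat.card H * Nat.card K) := by
  letI := dact H K
  have h := MulAction.sum_card_fixedBy_eq_card_orbits_mul_card_group (H × K) W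
  have h' := congrArg (Nat.cast : ℕ → ℚ) h
  rw [Fintype.card_prod] at h'
  push_cast at h'
  rw [Nat.card_eq_fintype_card (α := dorb H K), Nat.card_eq_fintype_card (α := H),
    Nat.card_eq_fintype_card (α := K)]
  refine Eq.trans ?_ h'
  rw [Fintype.sum_prod_type, ← Finset.sum_filter,
    Finset.sum_subtype (p := fun u => u ∈ H) _ (by simp)]
  refine Finset.sum_congr rfl fun a _ => ?_
  have h2 : ∀ b : K, (Fintype.card (MulAction.fixedBy W (a, b)) : ℚ) =
      ∑ x : W, if (a : W) * x * (b : W)⁻¹ = x then 1 else 0 := by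
    intro b
    rw [← card_eq, ← Nat.card_eq_fintype_card]
    rfl
  simp only [h2]
  rw [Finset.sum_comm, card_eq (fun x => x⁻¹ * (a : W) * x ∈ K)]
  refine Finset.sum_congr rfl fun x _ => ?_
  have h3 : ∀ b : W, (a : W) * x * b⁻¹ = x ↔ b = x⁻¹ * a * x := by
    intro b
    rw [mul_inv_eq_iff_eq_mul, mul_assoc, eq_inv_mul_iff_mul_eq, eq_comm]
  simp only [h3]
  split_ifs with hx
  · rw [Finset.sum_eq_single ⟨_, hx⟩]
    · simp
    · intro b _ hb
      rw [if_neg]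
      intro h; exact hb (Subtype.ext h)
    · simp
  · symm
    apply Finset.sum_eq_zero
    intro b _
    rw [if_neg]
    intro h; exact hx (h ▸ b.2)

theorem ff_inner (H K : Subgroup W) :
    ∑ w, ff H w * ff K w = Fintype.card W * Nat.card (dorb H K) := by
  rw [frob H _ (ff_conj K)]
  have : (∑ w, if w ∈ H then ff K w else 0) = (Nat.card K : ℚ)⁻¹ *
      ∑ u, if u ∈ H then (Nat.card {x : W // x⁻¹ * u * x ∈ K} : ℚ) else 0 := by
    rw [Finset.mul_sum]
    refine Finset.sum_congr rfl fun w _ => ?_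
    rw [ff]; split_ifs <;> simp
  rw [this, burn]
  have h1 : (Nat.card H : ℚ) ≠ 0 := by exact_mod_cast Nat.card_pos.ne'
  have h2 : (Nat.card K : ℚ) ≠ 0 := by exact_mod_cast Nat.card_pos.ne'
  field_simp

end

section
variable {B : Type*} [Fintype B] {W : Type*} [Group W] [Fintype W]
  {M : CoxeterMatrix B} (cs : CoxeterSystem M W)

/-- parabolic subgroup -/
abbrev par (J : Finset B) : Subgroup W := Subgroup.closure (cs.simple '' ↑J)

theorem card_dorb (K J : Finset B) :
    Nat.card (dorb (par cs K) (par cs J)) = Nat.card {d : W // IsMin cs (K : Set B) (J : Set B) d} := by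
  letI := dact (par cs K) (par cs J)
  symm
  have hrel : ∀ x y : W, MulAction.orbitRel (par cs K × par cs J) W x y ↔
      ∃ a b : List B, (∀ c ∈ a, c ∈ (K : Set B)) ∧ (∀ c ∈ b, c ∈ (J : Set B)) ∧
        x = cs.wordProd a * y * cs.wordProd b := by
    intro x y
    rw [MulAction.orbitRel_apply]
    constructor
    · rintro ⟨⟨⟨a, ha⟩, ⟨b, hb⟩⟩, rfl⟩
      obtain ⟨a', h1, rfl⟩ := word_of_mem cs _ a ha
      obtain ⟨b', h2, rfl⟩ := word_of_mem cs _ b hb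
      exact ⟨a', b'.reverse, h1, by simpa using h2, by rw [cs.wordProd_reverse]; rfl⟩
    · rintro ⟨a, b, ha, hb, rfl⟩
      refine ⟨⟨⟨_, mem_of_word cs _ a ha⟩, ⟨_, inv_mem (mem_of_word cs _ b hb)⟩⟩, ?_⟩
      change cs.wordProd a * y * ((cs.wordProd b)⁻¹)⁻¹ = _
      rw [inv_inv]
  have hmin : ∀ x : W, ∃ d, MulAction.orbitRel (par cs K × par cs J) W d x ∧
      ∀ y, MulAction.orbitRel (par cs K × par cs J) W y x → cs.length d ≤ cs.length y := by
    intro x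
    obtain ⟨d, hd, hd'⟩ := Set.exists_min_image
      {d | MulAction.orbitRel (par cs K × par cs J) W d x} cs.length (Set.toFinite _)
      ⟨x, Setoid.refl' (MulAction.orbitRel (par cs K × par cs J) W) x⟩
    exact ⟨d, hd, hd'⟩
  have huniq : ∀ x d, MulAction.orbitRel (par cs K × par cs J) W d x →
      (∀ y, MulAction.orbitRel (par cs K × par cs J) W y x → cs.length d ≤ cs.length y) →
      ∀ d', MulAction.orbitRel (par cs K × par cs J) W d' x →
      IsMin cs (K : Set B) (J : Set B) d' → d' = d := by
    intro x d h1 h2 d' h3 h4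
    obtain ⟨a, b, ha, hb, e⟩ := (hrel d' d).1 (Setoid.trans' _ h3 (Setoid.symm' _ h1))
    refine min_unique_aux cs K J d d' ?_ h4 _ a b ha hb rfl e
    intro a b ha hb
    exact h2 _ (Setoid.trans' _ ((hrel _ _).2 ⟨a, b, ha, hb, rfl⟩) h1)
  refine Nat.card_congr (Equiv.ofBijective (fun d => Quotient.mk _ d.1) ⟨?_, ?_⟩)
  · rintro ⟨d, hd⟩ ⟨d', hd'⟩ h
    have h : MulAction.orbitRel (par cs K × par cs J) W d d' := Quotient.exact h
    obtain ⟨e, he, he'⟩ := hmin d'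
    rw [Subtype.mk.injEq, huniq d' e he he' d h hd, huniq d' e he he' d' (Setoid.refl' _ _) hd']
  · intro q
    induction q using Quotient.inductionOn with
    | _ x =>
    obtain ⟨d, hd, hd'⟩ := hmin x
    refine ⟨⟨d, ?_, ?_⟩, Quotient.sound hd⟩
    · intro i hi h
      have := hd' (cs.simple i * d) (Setoid.trans' _ ((hrel _ _).2
        ⟨[i], [], by simpa using hi, by simp, by simp⟩) hd)
      exact absurd h (not_lt.2 this)
    · intro i hi h
      have := hd' (d * cs.simple i) (Setoid.trans' _ ((hrel _ _).2
        ⟨[], [i], by simp, by simpa using hi, by simp⟩) hd)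
      exact absurd h (not_lt.2 this)

theorem mobius (P : B → Prop) :
    (∑ J : Finset B, (-1 : ℚ) ^ J.card * if ∀ j ∈ J, ¬ P j then 1 else 0) =
      if ∀ i, P i then 1 else 0 := by
  have h := Finset.sum_powerset_neg_one_pow_card (x := Finset.univ.filter fun i => ¬ P i)
  have h' := congrArg (Int.cast : ℤ → ℚ) h
  push_cast at h'
  have e : (Finset.univ.filter fun i => ¬ P i) = ∅ ↔ ∀ i, P i := by
    simp [Finset.filter_eq_empty_iff]
  simp only [e] at h'
  rw [← h']
  simp only [mul_ite, mul_one, mul_zero]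
  rw [← Finset.sum_filter]
  refine Finset.sum_congr ?_ fun _ _ => rfl
  ext J
  simp [Finset.subset_iff]

theorem inner_chi :
    ∑ K : Finset B, ∑ J : Finset B, (-1 : ℚ) ^ K.card * (-1 : ℚ) ^ J.card *
      Nat.card (dorb (par cs K) (par cs J)) = 1 := by
  have h1 : ∀ K J : Finset B, (-1 : ℚ) ^ K.card * (-1 : ℚ) ^ J.card *
      Nat.card (dorb (par cs K) (par cs J)) =
      ∑ d : W, ((-1 : ℚ) ^ K.card * if ∀ j ∈ K, ¬ cs.IsLeftDescent d j then 1 else 0) *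
        ((-1 : ℚ) ^ J.card * if ∀ j ∈ J, ¬ cs.IsRightDescent d j then 1 else 0) := by
    intro K J
    rw [card_dorb, card_eq, Finset.mul_sum]
    refine Finset.sum_congr rfl fun d _ => ?_
    simp only [IsMin, Finset.mem_coe]
    by_cases h1 : ∀ j ∈ K, ¬ cs.IsLeftDescent d j <;>
    by_cases h2 : ∀ j ∈ J, ¬ cs.IsRightDescent d j
    · rw [if_pos ⟨h1, h2⟩, if_pos h1, if_pos h2]; ring
    · rw [if_neg (fun h => h2 h.2), if_neg h2]; ring
    · rw [if_neg (fun h => h1 h.1), if_neg h1]; ring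
    · rw [if_neg (fun h => h1 h.1), if_neg h1]; ring
  simp only [h1]
  have h2 : ∀ K : Finset B, (∑ J : Finset B, ∑ d : W,
      ((-1 : ℚ) ^ K.card * if ∀ j ∈ K, ¬ cs.IsLeftDescent d j then 1 else 0) *
        ((-1 : ℚ) ^ J.card * if ∀ j ∈ J, ¬ cs.IsRightDescent d j then 1 else 0)) =
      ∑ d : W, ((-1 : ℚ) ^ K.card * if ∀ j ∈ K, ¬ cs.IsLeftDescent d j then 1 else 0) *
        if ∀ i, cs.IsRightDescent d i then 1 else 0 := by
    intro K
    rw [Finset.sum_comm]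
    refine Finset.sum_congr rfl fun d _ => ?_
    rw [← Finset.mul_sum, mobius]
  simp only [h2]
  rw [Finset.sum_comm]
  simp only [← Finset.sum_mul, mobius]
  obtain ⟨u, hu, hu'⟩ := exists_top cs
  rw [Finset.sum_eq_single u]
  · rw [if_pos hu, if_pos hu']; simp
  · intro b _ hb
    rw [if_neg (c := ∀ i, cs.IsRightDescent b i), mul_zero]
    intro h; exact hb (top_unique cs b u h hu)
  · simp

/-- sign -/
noncomputable def sg (w : W) : ℚ := (-1) ^ cs.length w

theorem sg_mul (x y : W) : sg cs (x * y) = sg cs x * sg cs y := by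
  unfold sg
  rw [← pow_add, neg_one_pow_eq_pow_mod_two, cs.length_mul_mod_two, ← neg_one_pow_eq_pow_mod_two]

theorem sg_sq (x : W) : sg cs x * sg cs x = 1 := by
  unfold sg
  rw [← pow_add, ← two_mul]; simp

theorem sg_conj (x w : W) : sg cs (x * w * x⁻¹) = sg cs w := by
  have : sg cs x⁻¹ = sg cs x := by unfold sg; rw [cs.length_inv]
  rw [sg_mul, sg_mul, this, mul_comm, ← mul_assoc, sg_sq, one_mul]

theorem sum_sg (J : Finset B) :
    (∑ w, if w ∈ par cs J then sg cs w else 0) = if J = ∅ then 1 else 0 := by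
  split_ifs with h
  · subst h
    simp [par, sg, Subgroup.mem_bot]
  · obtain ⟨j, hj⟩ := Finset.nonempty_iff_ne_empty.2 h
    have hs : cs.simple j ∈ par cs J := Subgroup.subset_closure ⟨j, by simpa using hj, rfl⟩
    have : (∑ w, if w ∈ par cs J then sg cs w else 0) =
        ∑ w, -if w ∈ par cs J then sg cs w else 0 := by
      refine Fintype.sum_equiv (Equiv.mulRight (cs.simple j)) _ _ ?_
      intro w
      simp only [Equiv.coe_mulRight, Subgroup.mul_mem_cancel_right _ hs, sg_mul]
      have : sg cs (cs.simple j) = -1 := by simp [sg]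
      rw [this]; split_ifs <;> simp
    rw [Finset.sum_neg_distrib] at this
    linarith

theorem main (w : W) :
    ∑ J : Finset B, (-1 : ℚ) ^ J.card * ff (par cs J) w = sg cs w := by
  set χ : W → ℚ := fun w => ∑ J : Finset B, (-1 : ℚ) ^ J.card * ff (par cs J) w with hχ
  have h1 : ∑ w, χ w * χ w = Fintype.card W := by
    simp only [hχ, Finset.sum_mul_sum]
    rw [Finset.sum_comm]
    have : ∀ K : Finset B, ∑ w : W, ∑ J : Finset B, (-1 : ℚ) ^ K.card * ff (par cs K) w *
        ((-1 : ℚ) ^ J.card * ff (par cs J) w) = Fintype.card W * ∑ J : Finset B,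
        (-1 : ℚ) ^ K.card * (-1 : ℚ) ^ J.card * Nat.card (dorb (par cs K) (par cs J)) := by
      intro K
      rw [Finset.sum_comm, Finset.mul_sum]
      refine Finset.sum_congr rfl fun J _ => ?_
      rw [mul_left_comm, ← ff_inner, Finset.mul_sum]
      refine Finset.sum_congr rfl fun w _ => ?_
      ring
    simp only [this]
    rw [← Finset.mul_sum, inner_chi, mul_one]
  have h2 : ∑ w, χ w * sg cs w = Fintype.card W := by
    simp only [hχ, Finset.sum_mul]
    rw [Finset.sum_comm]
    have : ∀ J : Finset B, ∑ w : W, (-1 : ℚ) ^ J.card * ff (par cs J) w * sg cs w =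
        if J = ∅ then (Fintype.card W : ℚ) else 0 := by
      intro J
      simp only [mul_assoc]
      rw [← Finset.mul_sum, frob _ _ (sg_conj cs), sum_sg]
      split_ifs with h
      · subst h; simp [par]
      · simp
    simp only [this]
    simp
  have h3 : ∑ w, sg cs w * sg cs w = Fintype.card W := by
    simp [sg_sq]
  have h4 : ∑ w, (χ w - sg cs w) ^ 2 = 0 := by
    have : ∀ w, (χ w - sg cs w) ^ 2 = χ w * χ w - 2 * (χ w * sg cs w) + sg cs w * sg cs w := by
      intro w; ring
    simp only [this]
    rw [Finset.sum_add_distrib, Finset.sum_sub_distrib, ← Finset.mul_sum, h1, h2, h3]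
    ring
  rw [Finset.sum_eq_zero_iff_of_nonneg (fun _ _ => sq_nonneg _)] at h4
  have := h4 w (Finset.mem_univ _)
  exact sub_eq_zero.1 (pow_eq_zero_iff (two_ne_zero) |>.1 this)

end

end SteinAux

/-- The Steinberg character identity for a finite Coxeter group `(W, S)`:
the alternating sum over subsets `J ⊆ S` of the characters of the representations induced
from the trivial character of the standard parabolic subgroups `W_J` equals the sign
character `w ↦ (-1)^{ℓ(w)}`.  Explicitly, for every `w ∈ W`,
`Σ_{J ⊆ S} (-1)^{|J|} |W_J|⁻¹ #{x ∈ W : x⁻¹ w x ∈ W_J} = (-1)^{ℓ(w)}`. -/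
theorem steinberg_character_of_coxeter_system
    {B : Type*} [DecidableEq B] [Fintype B]
    {W : Type*} [Group W] [Fintype W]
    {M : CoxeterMatrix B} (cs : CoxeterSystem M W) (w : W) :
    ∑ J : Finset B,
      (-1 : ℂ) ^ J.card *
        ((Nat.card (Subgroup.closure (cs.simple '' ↑J)) : ℂ)⁻¹ *
          (Nat.card {x : W // x⁻¹ * w * x ∈ Subgroup.closure (cs.simple '' ↑J)} : ℂ)) =
      (-1 : ℂ) ^ cs.length w := by
  have h := congrArg (Rat.cast : ℚ → ℂ) (SteinAux.main cs w)
  simp only [SteinAux.ff, SteinAux.sg] at h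
  push_cast at h
  exact h
end

section
/- Let (W, S) be a Coxeter system with W a finite group and S finite. Define the duality operator D_W on complex-valued class functions on W by D_W(f) = Σ_{J ⊆ S} (-1)^{|J|} Ind_{W_J}^W(Res_{W_J} f). Then D_W is an involution: D_W(D_W(f)) = f for every class function f on W. (This is the finite Coxeter analogue, via the Curtis–Alvis duality the paper models, of the paper's Theorem 3.2(2) that the operator D_{R̃_σ, χ_σ} = Σ_{L ∈ 𝓛_A(M)} (-1)^{dim A_L} Ind ∘ Res is an involution.) -/
open scoped Classical

/-- Induction of class functions: for subgroups `H ≤ K` of a finite group `W` and a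
(class) function `f`, `Ind_H^K f (w) = |H|⁻¹ Σ_{x ∈ K, x⁻¹ w x ∈ H} f (x⁻¹ w x)`.
The ambient group of the induction is recorded as the subgroup `K`; induction from `H`
to the whole group `W` is `indCF ⊤ H`. -/
noncomputable def indCF {W : Type*} [Group W] [Fintype W] (K H : Subgroup W)
    (f : W → ℂ) : W → ℂ := fun w =>
  (Nat.card H : ℂ)⁻¹ *
    ∑ x : K, if (x : W)⁻¹ * w * (x : W) ∈ H then f ((x : W)⁻¹ * w * (x : W)) else 0

/-- The Curtis–Alvis style duality operator on class functions of a finite Coxeter group: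
`D (f) = Σ_{J ⊆ K} (-1)^{|J|} Ind_{W_J} (Res_{W_J} f)`, all inductions being taken inside
the ambient (parabolic) subgroup `A`; the duality of the full group `W = W_S` is
`dualCF cs ⊤ Finset.univ`.  Restriction of a class function is implicit: a function on a
subgroup is represented by a function on `W`, and `indCF` only uses its values on `W_J`. -/
noncomputable def dualCF {B : Type*} [DecidableEq B] [Fintype B]
    {W : Type*} [Group W] [Fintype W] {M : CoxeterMatrix B} (cs : CoxeterSystem M W)
    (A : Subgroup W) (K : Finset B) (f : W → ℂ) : W → ℂ := fun w =>
  ∑ J ∈ K.powerset, (-1 : ℂ) ^ J.card *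
    indCF A (Subgroup.closure (cs.simple '' ↑J)) f w


namespace DualAux

variable {B : Type*} {W : Type*} [Group W] {M : CoxeterMatrix B} (cs : CoxeterSystem M W)

/-- generator of the sign action on pairs -/
noncomputable def gen (i : B) : Function.End (W × ZMod 2) := fun p =>
  (cs.simple i * p.1 * cs.simple i, p.2 + if p.1 = cs.simple i then 1 else 0)

theorem conj_pow (i j : B) (l : ℕ) :
    cs.simple j * (cs.simple i * cs.simple j) ^ l =
      ((cs.simple i * cs.simple j)⁻¹) ^ l * cs.simple j := by
  induction l with
  | zero => simp
  | succ l ih =>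
    rw [pow_succ (cs.simple i * cs.simple j), ← mul_assoc, ih, pow_succ, mul_assoc, mul_assoc]
    congr 1
    simp [mul_assoc]

theorem gen_pow (i j : B) (k : ℕ) (t : W) (e : ZMod 2) :
    ((gen cs i * gen cs j) ^ k) (t, e) =
      ((cs.simple i * cs.simple j) ^ k * t * ((cs.simple i * cs.simple j) ^ k)⁻¹,
        e + ∑ p ∈ Finset.range (2 * k),
          if t = ((cs.simple i * cs.simple j)⁻¹) ^ p * cs.simple j then 1 else 0) := by
  induction k with
  | zero => simp; rfl
  | succ k ih =>
    rw [pow_succ']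
    change gen cs i (gen cs j (((gen cs i * gen cs j) ^ k) (t, e))) = _
    rw [ih, show 2 * (k + 1) = 2 * k + 1 + 1 by ring, Finset.sum_range_succ,
      Finset.sum_range_succ]
    set a := cs.simple i * cs.simple j with ha
    have hai : a⁻¹ = cs.simple j * cs.simple i := by simp [ha]
    have key : (a⁻¹) ^ k * cs.simple j * a ^ k = (a⁻¹) ^ (2 * k) * cs.simple j := by
      rw [mul_assoc, conj_pow, ← ha, ← mul_assoc, ← pow_add, two_mul]
    have h1 : (a ^ k * t * (a ^ k)⁻¹ = cs.simple j) ↔ t = (a⁻¹) ^ (2 * k) * cs.simple j := by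
      rw [← key, inv_pow]
      constructor
      · intro h; rw [← h]; group
      · intro h; rw [h]; group
    have h2 : (cs.simple j * (a ^ k * t * (a ^ k)⁻¹) * cs.simple j = cs.simple i) ↔
        t = (a⁻¹) ^ (2 * k + 1) * cs.simple j := by
      have : (a⁻¹) ^ (2 * k + 1) * cs.simple j =
          (a⁻¹) ^ k * (cs.simple j * cs.simple i * cs.simple j) * a ^ k := by
        rw [pow_succ', mul_assoc, ← key, ← hai]
        simp only [← mul_assoc, ← pow_succ, ← pow_succ']
      rw [this, inv_pow]
      constructor
      · intro h; rw [← h]; simp [mul_assoc]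
      · intro h; rw [h]; simp [mul_assoc]
    simp only [gen, h1, h2]
    rw [pow_succ' a k]
    refine Prod.ext ?_ ?_
    · simp only [mul_inv_rev, hai, mul_assoc]
      rw [ha]; simp only [mul_assoc]
    · simp [add_assoc]

theorem gen_liftable : M.IsLiftable (gen cs) := by
  intro i j
  funext ⟨t, e⟩
  rw [gen_pow, two_mul, Finset.sum_range_add]
  simp only [cs.simple_mul_simple_pow, pow_add, inv_pow]
  simp [CharTwo.add_self_eq_zero]
  rfl

/-- the sign action -/
noncomputable def act : W →* Function.End (W × ZMod 2) := cs.lift ⟨gen cs, gen_liftable cs⟩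

/-- the reflection cocycle -/
noncomputable def eta (w t : W) : ZMod 2 := (act cs w (t, 0)).2

theorem act_apply (w t : W) (e : ZMod 2) :
    act cs w (t, e) = (w * t * w⁻¹, e + eta cs w t) := by
  induction w using cs.simple_induction_left generalizing t e with
  | one =>
    rw [eta, map_one]
    change (t, e) = (1 * t * 1⁻¹, e + 0); simp
  | mul_simple_left w i ih =>
    have h (e) : act cs (cs.simple i * w) (t, e) = gen cs i (act cs w (t, e)) := by
      rw [map_mul]; simp only [act, cs.lift_apply_simple]; rfl
    rw [eta, h, h, ih, ih]
    simp [gen, mul_assoc, add_assoc]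

theorem eta_mul (x y t : W) : eta cs (x * y) t = eta cs y t + eta cs x (y * t * y⁻¹) := by
  have : act cs (x * y) (t, 0) = act cs x (act cs y (t, 0)) := by rw [map_mul]; rfl
  rw [act_apply, act_apply, act_apply] at this
  simpa using congrArg Prod.snd this

theorem eta_one (t : W) : eta cs 1 t = 0 := by simp [eta]; rfl

theorem eta_simple (i : B) (t : W) : eta cs (cs.simple i) t = if t = cs.simple i then 1 else 0 := by
  simp only [eta, act, cs.lift_apply_simple]; simp [gen]

theorem eta_word (ω : List B) (t : W) :
    eta cs (cs.wordProd ω) t = ((cs.rightInvSeq ω).count t : ZMod 2) := by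
  induction ω with
  | nil => simp [eta_one]
  | cons i ω ih =>
    rw [cs.wordProd_cons, eta_mul, ih, eta_simple, CoxeterSystem.rightInvSeq, List.count_cons]
    have : (cs.wordProd ω * t * (cs.wordProd ω)⁻¹ = cs.simple i) ↔
       ((cs.wordProd ω)⁻¹ * cs.simple i * cs.wordProd ω = t) := by
      constructor
      · intro h; rw [← h]; group
      · intro h; rw [← h]; group
    simp [this]

theorem eta_refl {t : W} (ht : cs.IsReflection t) : eta cs t t = 1 := by
  obtain ⟨u, i, rfl⟩ := ht
  have h0 : eta cs (u * u⁻¹) (u * cs.simple i * u⁻¹) = 0 := by simp [eta_one]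
  rw [eta_mul] at h0 ⊢
  rw [eta_mul, eta_simple]
  simp [mul_assoc] at h0 ⊢
  linear_combination h0

theorem mem_ris_of_eta {ω : List B} {t : W} (h : eta cs (cs.wordProd ω) t ≠ 0) :
    t ∈ cs.rightInvSeq ω := by
  rw [eta_word] at h
  by_contra hn
  exact h (by rw [List.count_eq_zero_of_not_mem hn]; rfl)

theorem lt_of_eta {w t : W} (h : eta cs w t ≠ 0) : cs.length (w * t) < cs.length w := by
  obtain ⟨ω, hω, rfl⟩ := cs.exists_isReduced w
  exact (cs.isRightInversion_of_mem_rightInvSeq hω (mem_ris_of_eta cs h)).2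

theorem eta_iff {w t : W} (ht : cs.IsReflection t) :
    eta cs w t ≠ 0 ↔ cs.length (w * t) < cs.length w := by
  refine ⟨lt_of_eta cs, fun h h0 => ?_⟩
  have h1 : eta cs (w * t) t ≠ 0 := by
    rw [eta_mul, eta_refl cs ht]; rw [mul_inv_cancel_right, h0]; simp
  have := lt_of_eta cs h1
  rw [mul_assoc, ht.mul_self, mul_one] at this
  omega

/-- exchange, cocycle form -/
theorem exch {x y : W} {i : B} (h1 : ¬ cs.length (y * cs.simple i) < cs.length y)
    (h2 : cs.length (x * y * cs.simple i) < cs.length (x * y)) :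
    cs.length (x * (y * cs.simple i * y⁻¹)) < cs.length x := by
  have hs := cs.isReflection_simple i
  rw [← eta_iff cs hs] at h1 h2
  rw [← eta_iff cs (hs.conj y)]
  rw [eta_mul] at h2
  simp only [not_not] at h1
  simpa [h1] using h2


/-- simple coroot -/
noncomputable def cor (M : CoxeterMatrix B) (i : B) : Module.Dual ℝ (B →₀ ℝ) :=
  Finsupp.linearCombination ℝ (fun j => -2 * Real.cos (Real.pi / (M i j : ℝ)))

theorem cor_single (i j : B) :
    cor M i (Finsupp.single j 1) = -2 * Real.cos (Real.pi / (M i j : ℝ)) := by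
  simp [cor]

theorem cor_self (i : B) : cor M i (Finsupp.single i 1) = 2 := by
  simp [cor_single]

open Polynomial.Chebyshev in
theorem refl_liftable : M.IsLiftable (fun i => Module.reflection (cor_self (M := M) i)) := by
  intro i j
  set m := M i j with hm
  by_cases h0 : m = 0
  · rw [h0, pow_zero]
  by_cases h1 : m = 1
  · have : i = j := by
      by_contra hne
      exact M.off_diagonal i j hne h1
    subst this
    rw [h1, pow_one]
    ext1 z
    rw [LinearEquiv.mul_apply, Module.involutive_reflection (cor_self i) z]
    rfl
  ext1 z
  have hf : cor M i (Finsupp.single j 1) = -2 * Real.cos (Real.pi / m) := cor_single i j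
  have hg : cor M j (Finsupp.single i 1) = -2 * Real.cos (Real.pi / m) := by
    rw [cor_single, M.symmetric j i]
  rw [Module.reflection_mul_reflection_pow_apply _ _ m z (2 * Real.cos (2 * (Real.pi / m)))
    (by rw [hf, hg, Real.cos_two_mul]; ring)]
  by_cases h2 : m = 2
  · rw [h2] at hf hg ⊢
    simp at hf hg
    rw [hf, hg]
    norm_num [show (2 : ℝ) * (Real.pi / 2) = Real.pi by ring]
    abel
  have hm3 : 3 ≤ m := by omega
  have hmR : (3 : ℝ) ≤ m := by exact_mod_cast hm3
  set θ := 2 * (Real.pi / m) with hθ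
  have hmθ : m * θ = 2 * Real.pi := by rw [hθ]; field_simp
  have hsin : Real.sin θ ≠ 0 := by
    apply ne_of_gt
    apply Real.sin_pos_of_pos_of_lt_pi
    · rw [hθ]; positivity
    · nlinarith [Real.pi_pos, show 0 < θ by rw [hθ]; positivity]
  rcases Nat.even_or_odd' m with ⟨n, hn | hn⟩
  · have e1 : ((m : ℤ) - 2) / 2 = n - 1 := by omega
    have e2 : ((m : ℤ) - 1) / 2 = n - 1 := by omega
    have hS : (S ℝ ((n : ℤ) - 1)).eval (2 * Real.cos θ) = 0 := by
      have := S_two_mul_real_cos θ ((n : ℤ) - 1)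
      have h3 : (((n : ℤ) - 1 : ℤ) + 1 : ℝ) * θ = Real.pi := by
        rw [hn] at hmθ; push_cast at hmθ ⊢; linarith
      rw [h3, Real.sin_pi] at this
      exact (mul_eq_zero.mp this).resolve_right hsin
    rw [e1, e2, hS]; simp
  · have e1 : ((m : ℤ) - 2) / 2 = n - 1 := by omega
    have e2 : ((m : ℤ) - 1) / 2 = n := by omega
    have e3 : ((m : ℤ) - 3) / 2 = n - 1 := by omega
    have e4 : (m : ℤ) / 2 = n := by omega
    have hS : (S ℝ (n : ℤ)).eval (2 * Real.cos θ) + (S ℝ ((n : ℤ) - 1)).eval (2 * Real.cos θ) = 0 := by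
      have a := S_two_mul_real_cos θ ((n : ℤ) - 1)
      have b := S_two_mul_real_cos θ (n : ℤ)
      have h3 : (((n : ℤ) : ℝ) + 1) * θ = 2 * Real.pi - (((n : ℤ) - 1 : ℤ) + 1 : ℝ) * θ := by
        rw [hn] at hmθ; push_cast at hmθ ⊢; linarith
      rw [h3, Real.sin_two_pi_sub] at b
      refine (mul_eq_zero.mp ?_).resolve_right hsin
      rw [add_mul, a, b]; ring
    rw [e1, e2, e3, e4, hS]; simp

theorem simple_inj : Function.Injective cs.simple := by
  intro i j hij
  by_contra hne
  have h := congrArg (cs.lift ⟨_, refl_liftable (M := M)⟩) hij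
  rw [cs.lift_apply_simple, cs.lift_apply_simple] at h
  have h2 := congrArg (fun e => e (Finsupp.single i (1 : ℝ)) i) h
  simp [Module.reflection_apply, hne] at h2
  norm_num at h2


/-- standard parabolic subgroup -/
abbrev P (J : Finset B) : Subgroup W := Subgroup.closure (cs.simple '' (↑J : Set B))

theorem simple_mem {J : Finset B} {j : B} (hj : j ∈ J) : cs.simple j ∈ P cs J :=
  Subgroup.subset_closure ⟨j, hj, rfl⟩

theorem word_mem {J : Finset B} {ω : List B} (h : ∀ i ∈ ω, i ∈ J) : cs.wordProd ω ∈ P cs J := by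
  induction ω with
  | nil => simp [one_mem]
  | cons i ω ih =>
    rw [cs.wordProd_cons]
    exact mul_mem (simple_mem cs (h i (by simp))) (ih fun k hk => h k (by simp [hk]))

theorem ris_mem {J : Finset B} {ω : List B} (h : ∀ i ∈ ω, i ∈ J) {t : W}
    (ht : t ∈ cs.rightInvSeq ω) : t ∈ P cs J := by
  induction ω with
  | nil => simp at ht
  | cons i ω ih =>
    have hω : ∀ k ∈ ω, k ∈ J := fun k hk => h k (by simp [hk])
    rw [CoxeterSystem.rightInvSeq, List.mem_cons] at ht
    rcases ht with rfl | ht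
    · exact mul_mem (mul_mem (inv_mem (word_mem cs hω)) (simple_mem cs (h i (by simp))))
        (word_mem cs hω)
    · exact ih hω ht

theorem exists_word {J : Finset B} {v : W} (hv : v ∈ P cs J) :
    ∃ ω : List B, cs.IsReduced ω ∧ (∀ i ∈ ω, i ∈ J) ∧ v = cs.wordProd ω := by
  have step : ∀ (x : W) (i : B), i ∈ J →
      (∃ ω : List B, cs.IsReduced ω ∧ (∀ i ∈ ω, i ∈ J) ∧ x = cs.wordProd ω) →
      ∃ ω : List B, cs.IsReduced ω ∧ (∀ i ∈ ω, i ∈ J) ∧ x * cs.simple i = cs.wordProd ω := by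
    rintro x i hi ⟨ω, hω, hJ, rfl⟩
    rcases cs.length_mul_simple (cs.wordProd ω) i with h | h
    · refine ⟨ω ++ [i], ?_, ?_, by simp [cs.wordProd_append]⟩
      · rw [CoxeterSystem.IsReduced, cs.wordProd_append, cs.wordProd_singleton, h, hω.eq]; simp
      · intro k hk
        rw [List.mem_append, List.mem_singleton] at hk
        rcases hk with hk | rfl
        · exact hJ k hk
        · exact hi
    · have hm : cs.simple i ∈ cs.rightInvSeq ω :=
        mem_ris_of_eta cs ((eta_iff cs (cs.isReflection_simple i)).2 (by omega))
      obtain ⟨n, hn, hn2⟩ := List.mem_iff_getElem.mp hm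
      have e : cs.wordProd ω * cs.simple i = cs.wordProd (ω.eraseIdx n) := by
        rw [← cs.wordProd_mul_getD_rightInvSeq, List.getD_eq_getElem _ 1 hn, hn2]
      refine ⟨ω.eraseIdx n, ?_, fun k hk => hJ k (List.mem_of_mem_eraseIdx hk), e⟩
      rw [cs.length_rightInvSeq] at hn
      have := List.length_eraseIdx_add_one hn
      have h3 := hω.eq
      rw [CoxeterSystem.IsReduced, ← e]
      omega
  induction hv using Subgroup.closure_induction_right with
  | one => exact ⟨[], by simp [CoxeterSystem.IsReduced], by simp, by simp⟩
  | mul_right x hx y hy ih =>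
    obtain ⟨i, hi, rfl⟩ := hy
    exact step _ _ hi ih
  | mul_inv_cancel x hx y hy ih =>
    obtain ⟨i, hi, rfl⟩ := hy
    rw [cs.inv_simple]
    exact step _ _ hi ih

theorem exists_desc {J : Finset B} {v : W} (hv : v ∈ P cs J) (h1 : v ≠ 1) :
    ∃ j ∈ J, cs.length (v * cs.simple j) < cs.length v := by
  obtain ⟨ω, hω, hJ, rfl⟩ := exists_word cs hv
  rcases List.eq_nil_or_concat ω with rfl | ⟨ω', i, rfl⟩
  · simp at h1
  · refine ⟨i, hJ i (by simp), ?_⟩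
    rw [hω.eq]
    have := cs.length_wordProd_le ω'
    simp [cs.wordProd_append]
    omega

theorem P_ind {J : Finset B} {p : W → Prop} (one : p 1)
    (step : ∀ v ∈ P cs J, ∀ j ∈ J, cs.length (v * cs.simple j) = cs.length v + 1 → p v →
      p (v * cs.simple j)) {v : W} (hv : v ∈ P cs J) : p v := by
  induction hn : cs.length v using Nat.strong_induction_on generalizing v with
  | _ n ih =>
    by_cases h1 : v = 1
    · rw [h1]; exact one
    · obtain ⟨j, hj, hlt⟩ := exists_desc cs hv h1
      have hm : v * cs.simple j ∈ P cs J := mul_mem hv (simple_mem cs hj)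
      have hl := cs.length_mul_simple v j
      have := step _ hm j hj (by simp; omega) (ih _ (by omega) hm rfl)
      simpa using this

theorem refl_mem {J : Finset B} {v t : W} (hv : v ∈ P cs J) (ht : cs.IsReflection t)
    (h : cs.length (v * t) < cs.length v) : t ∈ P cs J := by
  obtain ⟨ω, hω, hJ, rfl⟩ := exists_word cs hv
  exact ris_mem cs hJ (mem_ris_of_eta cs ((eta_iff cs ht).2 h))

theorem exists_simple {J : Finset B} {v : W} (hv : v ∈ P cs J) (h : cs.length v = 1) :
    ∃ j ∈ J, v = cs.simple j := by
  obtain ⟨ω, hω, hJ, rfl⟩ := exists_word cs hv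
  obtain ⟨i, rfl⟩ := List.length_eq_one_iff.mp (hω.eq.symm.trans h)
  exact ⟨i, hJ i (by simp), by simp⟩

/-- minimal on the right with respect to J -/
def Rmin (J : Finset B) (y : W) : Prop :=
  ∀ j ∈ J, ¬ cs.length (y * cs.simple j) < cs.length y

theorem len_add_of_min {J : Finset B} {y : W} (hy : ∀ v ∈ P cs J, cs.length y ≤ cs.length (y * v))
    {v : W} (hv : v ∈ P cs J) : cs.length (y * v) = cs.length y + cs.length v := by
  refine P_ind cs (p := fun v => cs.length (y * v) = cs.length y + cs.length v) (by simp) ?_ hv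
  intro v hv j hj hl ih
  rcases cs.length_mul_simple (y * v) j with h | h
  · rw [← mul_assoc, h, ih, hl]; ring
  · have := exch cs (x := y) (y := v) (i := j) (by omega) (by omega)
    have h2 := hy _ (mul_mem (mul_mem hv (simple_mem cs hj)) (inv_mem hv))
    omega

theorem decomp_min [Finite W] (J : Finset B) (x : W) : ∃ y v, x = y * v ∧ v ∈ P cs J ∧
    ∀ v ∈ P cs J, cs.length y ≤ cs.length (y * v) := by
  obtain ⟨u, hu, hmin⟩ := Set.exists_min_image (P cs J : Set W) (fun u => cs.length (x * u))
    (Set.toFinite _) ⟨1, one_mem _⟩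
  refine ⟨x * u, u⁻¹, by simp, inv_mem hu, fun v hv => ?_⟩
  rw [mul_assoc]
  exact hmin _ (mul_mem hu hv)

theorem Rmin.min [Finite W] {J : Finset B} {y : W} (h : Rmin cs J y) :
    ∀ v ∈ P cs J, cs.length y ≤ cs.length (y * v) := by
  obtain ⟨z, u, rfl, hu, hz⟩ := decomp_min cs J y
  by_cases h1 : u = 1
  · subst h1; simpa using hz
  · obtain ⟨j, hj, hl⟩ := exists_desc cs hu h1
    have a := h j hj
    rw [mul_assoc, len_add_of_min cs hz hu,
      len_add_of_min cs hz (mul_mem hu (simple_mem cs hj))] at a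
    omega

theorem Rmin.len_add [Finite W] {J : Finset B} {y : W} (h : Rmin cs J y) {v : W}
    (hv : v ∈ P cs J) : cs.length (y * v) = cs.length y + cs.length v :=
  len_add_of_min cs (Rmin.min cs h) hv

theorem Rmin.len_add' [Finite W] {K : Finset B} {d : W} (h : Rmin cs K d⁻¹) {u : W}
    (hu : u ∈ P cs K) : cs.length (u * d) = cs.length u + cs.length d := by
  have := Rmin.len_add cs h (inv_mem hu)
  rw [← mul_inv_rev, cs.length_inv, cs.length_inv, cs.length_inv] at this
  omega

theorem decomp [Finite W] (J : Finset B) (x : W) : ∃ y v, x = y * v ∧ v ∈ P cs J ∧ Rmin cs J y := by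
  obtain ⟨y, v, h, hv, hm⟩ := decomp_min cs J x
  refine ⟨y, v, h, hv, fun j hj => ?_⟩
  have := hm _ (simple_mem cs hj)
  omega

theorem kilmoyer [Finite W] {K J : Finset B} {d : W} (hK : Rmin cs K d⁻¹) (hJ : Rmin cs J d)
    {v : W} (hv : v ∈ P cs J) : d * v * d⁻¹ ∈ P cs K →
    d * v * d⁻¹ ∈ P cs (K.filter fun k => ∃ j ∈ J, cs.simple k * d = d * cs.simple j) := by
  refine P_ind cs (p := fun v => d * v * d⁻¹ ∈ P cs K → d * v * d⁻¹ ∈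
    P cs (K.filter fun k => ∃ j ∈ J, cs.simple k * d = d * cs.simple j))
    (by intro _; simp [one_mem]) ?_ hv
  intro v hv j hj hl ih hw
  have h1 := Rmin.len_add cs hJ hv
  have h2 := Rmin.len_add cs hJ (mul_mem hv (simple_mem cs hj))
  have hx := exch cs (x := d * (v * cs.simple j) * d⁻¹) (y := d) (i := j) (hJ j hj) (by
    simp only [inv_mul_cancel_right]
    rw [h2, ← mul_assoc, cs.simple_mul_simple_cancel_right, h1]; omega)
  have hg := refl_mem cs hw ((cs.isReflection_simple j).conj d) hx
  have hlen : cs.length (d * cs.simple j * d⁻¹) = 1 := by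
    have a := Rmin.len_add' cs hK hg
    have b := Rmin.len_add cs hJ (simple_mem cs hj)
    rw [inv_mul_cancel_right, b, cs.length_simple] at a
    omega
  obtain ⟨k, hk, hgk⟩ := exists_simple cs hg hlen
  have e : d * v * d⁻¹ = d * (v * cs.simple j) * d⁻¹ * (d * cs.simple j * d⁻¹) := by
    simp [mul_assoc]
  have e2 : d * (v * cs.simple j) * d⁻¹ = d * v * d⁻¹ * (d * cs.simple j * d⁻¹) := by
    simp [mul_assoc]
  rw [e2]
  refine mul_mem (ih (by rw [e]; exact mul_mem hw hg)) ?_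
  rw [hgk]
  refine simple_mem cs (Finset.mem_filter.2 ⟨hk, j, hj, ?_⟩)
  rw [← hgk]; simp

theorem full_len {J : Finset B} {x : W} (h : ∀ j ∈ J, cs.length (x * cs.simple j) < cs.length x)
    {v : W} (hv : v ∈ P cs J) : cs.length (x * v⁻¹) + cs.length v = cs.length x := by
  refine P_ind cs (p := fun v => cs.length (x * v⁻¹) + cs.length v = cs.length x) (by simp) ?_ hv
  intro v hv j hj hl ih
  have := exch cs (x := x * v⁻¹) (y := v) (i := j) (by omega) (by simpa using h j hj)
  have e : x * v⁻¹ * (v * cs.simple j * v⁻¹) = x * (v * cs.simple j)⁻¹ := by simp [mul_assoc]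
  rw [e] at this
  have h3 := cs.length_mul_le (x * (v * cs.simple j)⁻¹) (v * cs.simple j)
  rw [inv_mul_cancel_right] at h3
  omega

theorem longest [Finite W] (J : Finset B) : ∃ a ∈ P cs J, a * a = 1 ∧
    ∀ u ∈ P cs J, cs.length (a * u) + cs.length u = cs.length a := by
  obtain ⟨a, ha, hmax⟩ := Set.exists_max_image (P cs J : Set W) (fun u => cs.length u)
    (Set.toFinite _) ⟨1, one_mem _⟩
  have hd : ∀ j ∈ J, cs.length (a * cs.simple j) < cs.length a := by
    intro j hj
    have h1 : cs.length (a * cs.simple j) ≤ cs.length a := hmax _ (mul_mem ha (simple_mem cs hj))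
    have := cs.length_mul_simple_ne a j
    omega
  have hl : ∀ u ∈ P cs J, cs.length (a * u) + cs.length u = cs.length a := by
    intro u hu
    have := full_len cs hd (inv_mem hu)
    simpa using this
  refine ⟨a, ha, ?_, hl⟩
  have := hl a ha
  exact cs.length_eq_zero_iff.1 (by omega)

theorem P_univ [Fintype B] : P cs Finset.univ = ⊤ := by
  rw [P, Finset.coe_univ, Set.image_univ, cs.subgroup_closure_range_simple]

/-- the key unique element -/
theorem key_unique [Finite W] [Fintype B] (K : Finset B) : ∃ x₀ : W, ∀ x : W,
    ((∀ k ∈ K, ∃ j, cs.simple k * x = x * cs.simple j) ∧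
      (∀ j, ¬ cs.length (x * cs.simple j) < cs.length x →
        ∃ k ∈ K, cs.simple k * x = x * cs.simple j) ∧ Rmin cs K x⁻¹) ↔ x = x₀ := by
  obtain ⟨a, ha, haa, hal⟩ := longest cs K
  obtain ⟨z, -, hzz, hzl⟩ := longest cs (Finset.univ : Finset B)
  replace hzl : ∀ u, cs.length (z * u) + cs.length u = cs.length z :=
    fun u => hzl u (by rw [P_univ]; trivial)
  have hai : a⁻¹ = a := inv_eq_of_mul_eq_one_left haa
  have hzi : z⁻¹ = z := inv_eq_of_mul_eq_one_left hzz
  have hcomm : ∀ u, cs.length (u * z) + cs.length u = cs.length z := by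
    intro u
    have := hzl u⁻¹
    rw [← cs.length_inv (z * u⁻¹), cs.length_inv u] at this
    simpa [hzi] using this
  have hzconj : ∀ u, cs.length (z * u * z) = cs.length u := by
    intro u
    have h1 := hzl (u * z)
    have h2 := hcomm u
    rw [mul_assoc]
    omega
  have haconj : ∀ u ∈ P cs K, cs.length (a * u * a) = cs.length u := by
    intro u hu
    have h1 := hal (u * a) (mul_mem hu ha)
    have h2 := hal u⁻¹ (inv_mem hu)
    rw [← cs.length_inv (a * u⁻¹), cs.length_inv u] at h2
    simp [hai] at h2
    rw [mul_assoc]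
    omega
  refine ⟨a * z, fun x => ⟨?_, ?_⟩⟩
  · rintro ⟨-, h2, h3⟩
    have hax := Rmin.len_add' cs h3 ha
    have hfull : ∀ j ∈ (Finset.univ : Finset B),
        cs.length (a * x * cs.simple j) < cs.length (a * x) := by
      intro j _
      by_cases hj : cs.length (x * cs.simple j) < cs.length x
      · have := cs.length_mul_le a (x * cs.simple j)
        rw [mul_assoc]; omega
      · obtain ⟨k, hk, hkx⟩ := h2 j hj
        have := cs.length_mul_le (a * cs.simple k) x
        have h5 := hal _ (simple_mem cs hk)
        rw [cs.length_simple] at h5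
        rw [mul_assoc, ← hkx, ← mul_assoc]; omega
    have h6 := full_len cs hfull (v := z⁻¹) (by rw [P_univ]; trivial)
    rw [inv_inv, cs.length_inv] at h6
    have h7 := hcomm (a * x)
    have h8 : a * x * z = 1 := cs.length_eq_zero_iff.1 (by omega)
    have h9 : a * x = z := by rw [← hzi]; exact eq_inv_of_mul_eq_one_left h8
    rw [← h9, ← mul_assoc, haa, one_mul]
  · rintro rfl
    refine ⟨?_, ?_, ?_⟩
    · intro k hk
      have h1 : cs.length (z * (a * cs.simple k * a) * z) = 1 := by
        rw [hzconj, haconj _ (simple_mem cs hk), cs.length_simple]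
      obtain ⟨j, hj⟩ := cs.length_eq_one_iff.1 h1
      refine ⟨j, ?_⟩
      rw [← hj]
      have : a * z * (z * (a * cs.simple k * a) * z) = a * (z * z) * a * cs.simple k * a * z := by
        simp only [mul_assoc]
      rw [this, hzz, mul_one, haa, one_mul, mul_assoc]
    · intro j hj
      have h1 : cs.length (z * cs.simple j * z) = 1 := by rw [hzconj, cs.length_simple]
      obtain ⟨i, hi⟩ := cs.length_eq_one_iff.1 h1
      have e : a * z * cs.simple j = a * cs.simple i * z := by
        rw [← hi]; simp only [mul_assoc, hzz, mul_one]
      have b1 := hcomm (a * cs.simple i)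
      have b2 := hcomm a
      have b3 := cs.length_mul_simple_ne a i
      rw [e] at hj
      have hiK := refl_mem cs ha (cs.isReflection_simple i) (by omega)
      obtain ⟨k, hk, hk2⟩ := exists_simple cs (mul_mem (mul_mem ha hiK) ha)
        ((haconj _ hiK).trans (cs.length_simple i))
      refine ⟨k, hk, ?_⟩
      rw [← hk2, e]
      have : a * cs.simple i * a * (a * z) = a * cs.simple i * (a * a) * z := by
        simp only [mul_assoc]
      rw [this, haa, mul_one]
    · intro k hk h
      rw [mul_inv_rev, hai, hzi, mul_assoc] at h
      have b1 := hzl (a * cs.simple k)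
      have b2 := hzl a
      have b3 := hal _ (simple_mem cs hk)
      rw [cs.length_simple] at b3
      omega


theorem interval_sum [Fintype B] (T C : Finset B) :
    ∑ J : Finset B, (if T ⊆ J ∧ J ⊆ C then (-1 : ℂ) ^ J.card else 0) =
      if T = C then (-1 : ℂ) ^ T.card else 0 := by
  by_cases hTC : T ⊆ C
  · have h1 : ∑ J : Finset B, (if T ⊆ J ∧ J ⊆ C then (-1 : ℂ) ^ J.card else 0) =
        ∑ A ∈ (C \ T).powerset, (-1 : ℂ) ^ T.card * (-1 : ℂ) ^ A.card := by
      rw [← Finset.sum_filter]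
      refine Finset.sum_bij' (fun J _ => J \ T) (fun A _ => T ∪ A) ?_ ?_ ?_ ?_ ?_
      · intro J hJ
        simp only [Finset.mem_filter, Finset.mem_univ, true_and] at hJ
        exact Finset.mem_powerset.2 (Finset.sdiff_subset_sdiff hJ.2 (Finset.Subset.refl _))
      · intro A hA
        rw [Finset.mem_powerset] at hA
        simp only [Finset.mem_filter, Finset.mem_univ, true_and]
        exact ⟨Finset.subset_union_left,
          Finset.union_subset hTC (hA.trans Finset.sdiff_subset)⟩
      · intro J hJ
        simp only [Finset.mem_filter, Finset.mem_univ, true_and] at hJ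
        exact Finset.union_sdiff_of_subset hJ.1
      · intro A hA
        rw [Finset.mem_powerset] at hA
        ext b
        have := @hA b
        simp only [Finset.mem_sdiff, Finset.mem_union] at this ⊢
        tauto
      · intro J hJ
        simp only [Finset.mem_filter, Finset.mem_univ, true_and] at hJ
        rw [← pow_add, add_comm, Finset.card_sdiff_add_card_eq_card hJ.1]
    rw [h1, ← Finset.mul_sum]
    have h2 := congrArg (Int.cast : ℤ → ℂ) (Finset.sum_powerset_neg_one_pow_card (x := C \ T))
    push_cast at h2
    rw [h2]
    simp only [Finset.sdiff_eq_empty_iff_subset]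
    by_cases h : T = C
    · simp [h]
    · have : ¬ C ⊆ T := fun h' => h (Finset.Subset.antisymm hTC h')
      simp [h, this]
  · rw [if_neg (fun h => hTC h.subset)]
    refine Finset.sum_eq_zero fun J _ => if_neg fun h => hTC (h.1.trans h.2)

/-- permutation character of the cosets of H -/
noncomputable def cnt [Fintype W] (H : Subgroup W) (w : W) : ℂ :=
  (Nat.card H : ℂ)⁻¹ * ∑ x : W, if x⁻¹ * w * x ∈ H then 1 else 0

theorem indCF_eq [Fintype W] (H : Subgroup W) (f : W → ℂ)
    (hf : ∀ x w : W, f (x⁻¹ * w * x) = f w) (w : W) : indCF ⊤ H f w = cnt H w * f w := by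
  unfold indCF cnt
  rw [mul_assoc, Finset.sum_mul]
  congr 1
  refine Fintype.sum_equiv (Subgroup.topEquiv (G := W)).toEquiv _ _ fun x => ?_
  simp [hf]

theorem cnt_conj [Fintype W] (H : Subgroup W) (g w : W) : cnt H (g⁻¹ * w * g) = cnt H w := by
  unfold cnt
  congr 1
  refine Fintype.sum_equiv (Equiv.mulLeft g) _ _ fun x => ?_
  simp [mul_assoc]

theorem cnt_eq [Fintype W] (J : Finset B) (w : W) :
    cnt (P cs J) w = ∑ y : W, if Rmin cs J y ∧ y⁻¹ * w * y ∈ P cs J then 1 else 0 := by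
  have hbij : Function.Bijective
      (fun p : {y : W // Rmin cs J y} × P cs J => (p.1 : W) * (p.2 : W)) := by
    constructor
    · rintro ⟨⟨y, hy⟩, ⟨v, hv⟩⟩ ⟨⟨y', hy'⟩, ⟨v', hv'⟩⟩ h
      simp only at h
      have e : y' = y * (v * v'⁻¹) := by rw [← mul_assoc, h]; simp
      have hm : v * v'⁻¹ ∈ P cs J := mul_mem hv (inv_mem hv')
      have l1 := Rmin.len_add cs hy hm
      have l2 := Rmin.len_add cs hy' (inv_mem hm)
      rw [← e] at l1
      have e2 : y' * (v * v'⁻¹)⁻¹ = y := by rw [e, mul_inv_cancel_right]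
      rw [e2] at l2
      have h0 : v * v'⁻¹ = 1 := cs.length_eq_zero_iff.1 (by omega)
      have hv' : v = v' := mul_inv_eq_one.1 h0
      subst hv'
      simp at e
      subst e
      rfl
    · intro x
      obtain ⟨y, v, rfl, hv, hy⟩ := decomp cs J x
      exact ⟨⟨⟨y, hy⟩, ⟨v, hv⟩⟩, rfl⟩
  unfold cnt
  rw [← hbij.sum_comp, Fintype.sum_prod_type]
  have hin : ∀ (y : {y : W // Rmin cs J y}) (v : P cs J),
      (((y : W) * (v : W))⁻¹ * w * ((y : W) * (v : W)) ∈ P cs J) ↔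
        ((y : W)⁻¹ * w * (y : W) ∈ P cs J) := by
    intro y v
    have e : ((y : W) * (v : W))⁻¹ * w * ((y : W) * (v : W)) =
      (v : W)⁻¹ * ((y : W)⁻¹ * w * (y : W)) * (v : W) := by simp [mul_assoc]
    rw [e, Subgroup.mul_mem_cancel_right _ v.2, Subgroup.mul_mem_cancel_left _ (inv_mem v.2)]
  simp only [hin, Finset.sum_const, Finset.card_univ, nsmul_eq_mul]
  rw [← Finset.mul_sum, ← mul_assoc, Nat.card_eq_fintype_card, inv_mul_cancel₀, one_mul]
  · simp only [ite_and]
    rw [← Finset.sum_filter]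
    rw [Finset.sum_filter, ← Finset.sum_filter (fun y => Rmin cs J y)]
    exact (Finset.sum_subtype (p := fun y => Rmin cs J y)
      (Finset.univ.filter fun y => Rmin cs J y) (fun x => by simp)
      (fun y => if y⁻¹ * w * y ∈ P cs J then (1 : ℂ) else 0)).symm
  · exact_mod_cast Fintype.card_ne_zero

/-- the character -/
noncomputable def chi [Fintype B] [Fintype W] (w : W) : ℂ :=
  ∑ J : Finset B, (-1 : ℂ) ^ J.card * cnt (P cs J) w

theorem chi_conj [Fintype B] [Fintype W] (g w : W) : chi cs (g⁻¹ * w * g) = chi cs w := by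
  simp only [chi, cnt_conj]

theorem cond_iff [Fintype B] [Fintype W] {K : Finset B} {w : W} (hw : w ∈ P cs K)
    (hmin : ∀ (L : Finset B) (g : W), g⁻¹ * w * g ∈ P cs L → K.card ≤ L.card)
    (J : Finset B) (x : W) :
    (Rmin cs J x ∧ x⁻¹ * w * x ∈ P cs J) ↔
      (((∀ k ∈ K, ∃ j, cs.simple k * x = x * cs.simple j) ∧ Rmin cs K x⁻¹) ∧
        ((Finset.univ.filter fun j => ∃ k ∈ K, cs.simple k * x = x * cs.simple j) ⊆ J ∧
          J ⊆ Finset.univ.filter fun j => ¬ cs.length (x * cs.simple j) < cs.length x)) := by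
  constructor
  · rintro ⟨hJ, hx⟩
    have hgood : ∀ k ∈ K, ∃ j ∈ J, cs.simple k * x = x * cs.simple j := by
      obtain ⟨d', u', hxd, hu', hd'⟩ := decomp cs K x⁻¹
      obtain ⟨d, rfl⟩ : ∃ d, d' = d⁻¹ := ⟨d'⁻¹, by simp⟩
      obtain ⟨u, rfl⟩ : ∃ u, u' = u⁻¹ := ⟨u'⁻¹, by simp⟩
      rw [inv_mem_iff] at hu'
      rw [← mul_inv_rev, inv_inj] at hxd
      subst hxd
      have hl := Rmin.len_add' cs hd' hu'
      have hdJ : Rmin cs J d := by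
        intro j hj h
        apply hJ j hj
        have := cs.length_mul_le u (d * cs.simple j)
        rw [mul_assoc]
        omega
      have hk := kilmoyer cs hd' hdJ hx (by
        have e : d * ((u * d)⁻¹ * w * (u * d)) * d⁻¹ = u⁻¹ * w * u := by simp [mul_assoc]
        rw [e]
        exact mul_mem (mul_mem (inv_mem hu') hw) hu')
      have e : d * ((u * d)⁻¹ * w * (u * d)) * d⁻¹ = u⁻¹ * w * u := by simp [mul_assoc]
      rw [e] at hk
      have hc := hmin _ _ hk
      have hKe := Finset.eq_of_subset_of_card_le (Finset.filter_subset _ K) hc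
      have hall : ∀ k ∈ K, ∃ j ∈ J, cs.simple k * d = d * cs.simple j := by
        intro k hk
        rw [← hKe] at hk
        exact (Finset.mem_filter.1 hk).2
      have hu1 : u = 1 := by
        by_contra hne
        obtain ⟨k, hkK, hlt⟩ := exists_desc cs hu' hne
        obtain ⟨j, hj, hkd⟩ := hall k hkK
        apply hJ j hj
        rw [mul_assoc, ← hkd, ← mul_assoc]
        have := cs.length_mul_le (u * cs.simple k) d
        omega
      subst hu1
      simpa using hall
    refine ⟨⟨fun k hk => ?_, ?_⟩, ?_, ?_⟩
    · obtain ⟨j, -, h⟩ := hgood k hk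
      exact ⟨j, h⟩
    · intro k hk h
      obtain ⟨j, hj, hkx⟩ := hgood k hk
      apply hJ j hj
      rw [← hkx, ← cs.length_inv, mul_inv_rev, cs.inv_simple, ← cs.length_inv x]
      exact h
    · intro j hj
      obtain ⟨k, hk, hkx⟩ := (Finset.mem_filter.1 hj).2
      obtain ⟨j', hj', hkx'⟩ := hgood k hk
      rw [hkx'] at hkx
      have := simple_inj cs (mul_left_cancel hkx)
      rwa [← this]
    · intro j hj
      exact Finset.mem_filter.2 ⟨Finset.mem_univ _, hJ j hj⟩
  · rintro ⟨⟨hv, -⟩, hT, hC⟩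
    refine ⟨fun j hj => (Finset.mem_filter.1 (hC hj)).2, ?_⟩
    have hle : P cs K ≤ (P cs J).comap (MulAut.conj x⁻¹).toMonoidHom := by
      rw [P, Subgroup.closure_le]
      rintro _ ⟨k, hk, rfl⟩
      obtain ⟨j, hj⟩ := hv k hk
      have hjJ : j ∈ J := hT (Finset.mem_filter.2 ⟨Finset.mem_univ _, k, hk, hj⟩)
      have e : x⁻¹ * cs.simple k * x = cs.simple j := by rw [mul_assoc, hj]; simp
      have := simple_mem cs hjJ
      rw [← e] at this
      simpa using this
    simpa using hle hw

theorem chi_sq_aux [Fintype B] [Fintype W] {K : Finset B} {w : W} (hw : w ∈ P cs K)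
    (hmin : ∀ (L : Finset B) (g : W), g⁻¹ * w * g ∈ P cs L → K.card ≤ L.card) :
    chi cs w * chi cs w = 1 := by
  obtain ⟨x₀, hx₀⟩ := key_unique cs K
  let T : W → Finset B := fun x =>
    Finset.univ.filter fun j => ∃ k ∈ K, cs.simple k * x = x * cs.simple j
  let C : W → Finset B := fun x =>
    Finset.univ.filter fun j => ¬ cs.length (x * cs.simple j) < cs.length x
  have h : chi cs w = (-1 : ℂ) ^ (T x₀).card := by
    unfold chi
    simp only [cnt_eq, Finset.mul_sum]
    rw [Finset.sum_comm]
    have hin : ∀ x : W, ∑ J : Finset B, (-1 : ℂ) ^ J.card *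
        (if Rmin cs J x ∧ x⁻¹ * w * x ∈ P cs J then (1 : ℂ) else 0) =
        if x = x₀ then (-1 : ℂ) ^ (T x).card else 0 := by
      intro x
      have hiff := fun J => cond_iff cs hw hmin J x
      by_cases hv : (∀ k ∈ K, ∃ j, cs.simple k * x = x * cs.simple j) ∧ Rmin cs K x⁻¹
      · have hTC : T x ⊆ C x := by
          intro j hj
          obtain ⟨k, hk, hkx⟩ := (Finset.mem_filter.1 hj).2
          refine Finset.mem_filter.2 ⟨Finset.mem_univ _, fun hlt => hv.2 k hk ?_⟩
          rw [← hkx, ← cs.length_inv, mul_inv_rev, cs.inv_simple, ← cs.length_inv x] at hlt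
          exact hlt
        have hE : T x = C x ↔ x = x₀ := by
          rw [← hx₀ x]
          constructor
          · intro he
            refine ⟨hv.1, fun j hj => ?_, hv.2⟩
            have : j ∈ T x := by rw [he]; exact Finset.mem_filter.2 ⟨Finset.mem_univ _, hj⟩
            exact (Finset.mem_filter.1 this).2
          · rintro ⟨-, h2, -⟩
            refine Finset.Subset.antisymm hTC fun j hj => ?_
            exact Finset.mem_filter.2 ⟨Finset.mem_univ _, h2 j (Finset.mem_filter.1 hj).2⟩
        have hs := interval_sum (T x) (C x)
        simp only [hE] at hs
        rw [← hs]
        refine Finset.sum_congr rfl fun J _ => ?_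
        have h3 : (Rmin cs J x ∧ x⁻¹ * w * x ∈ P cs J) ↔ (T x ⊆ J ∧ J ⊆ C x) :=
          (hiff J).trans ⟨fun h => h.2, fun h => ⟨hv, h⟩⟩
        simp only [h3, mul_ite, mul_one, mul_zero]
      · have hne : x ≠ x₀ := fun he => hv ⟨((hx₀ x).2 he).1, ((hx₀ x).2 he).2.2⟩
        rw [if_neg hne]
        refine Finset.sum_eq_zero fun J _ => ?_
        rw [if_neg (fun h => hv ((hiff J).1 h).1), mul_zero]
    rw [Finset.sum_congr rfl fun x _ => hin x]
    simp
  rw [h, ← pow_add, ← two_mul, pow_mul]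
  simp

theorem chi_sq [Fintype B] [Fintype W] (w : W) : chi cs w * chi cs w = 1 := by
  obtain ⟨K, hK, hmin⟩ := Finset.exists_min_image
    (Finset.univ.filter fun K : Finset B => ∃ g : W, g⁻¹ * w * g ∈ P cs K) Finset.card
    ⟨Finset.univ, Finset.mem_filter.2 ⟨Finset.mem_univ _, 1, by rw [P_univ]; trivial⟩⟩
  obtain ⟨g, hg⟩ := (Finset.mem_filter.1 hK).2
  rw [← chi_conj cs g w]
  refine chi_sq_aux cs hg fun L h hL => ?_
  refine hmin L (Finset.mem_filter.2 ⟨Finset.mem_univ _, g * h, ?_⟩)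
  have e : (g * h)⁻¹ * w * (g * h) = h⁻¹ * (g⁻¹ * w * g) * h := by simp [mul_assoc]
  rwa [e]

theorem dual_eq [DecidableEq B] [Fintype B] [Fintype W] (f : W → ℂ)
    (hf : ∀ x w : W, f (x⁻¹ * w * x) = f w) (w : W) :
    dualCF cs ⊤ Finset.univ f w = chi cs w * f w := by
  unfold dualCF chi
  rw [Finset.powerset_univ, Finset.sum_mul]
  refine Finset.sum_congr rfl fun J _ => ?_
  rw [indCF_eq _ f hf, mul_assoc]



end DualAux

/-- The duality operator `D_W (f) = Σ_{J ⊆ S} (-1)^{|J|} Ind_{W_J}^W (Res_{W_J} f)` on class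
functions of a finite Coxeter group `(W, S)` is an involution: `D_W (D_W f) = f`. -/
theorem dualCF_involutive
    {B : Type*} [DecidableEq B] [Fintype B]
    {W : Type*} [Group W] [Fintype W]
    {M : CoxeterMatrix B} (cs : CoxeterSystem M W)
    (f : W → ℂ) (hf : ∀ x w : W, f (x⁻¹ * w * x) = f w) :
    dualCF cs ⊤ Finset.univ (dualCF cs ⊤ Finset.univ f) = f := by
  have h1 : dualCF cs ⊤ Finset.univ f = fun w => DualAux.chi cs w * f w :=
    funext fun w => DualAux.dual_eq cs f hf w
  funext w
  rw [h1, DualAux.dual_eq cs (fun w => DualAux.chi cs w * f w)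
    (fun x w => by simp only [DualAux.chi_conj, hf]) w, ← mul_assoc, DualAux.chi_sq, one_mul]
end

section
/- Let (W, S) be a Coxeter system with W a finite group and S finite, and let K ⊆ S. For a Coxeter group, define the duality operator on class functions of W by D_W(f) = Σ_{J ⊆ S} (-1)^{|J|} Ind_{W_J}^W(Res_{W_J} f), and on class functions of the standard parabolic subgroup W_K by D_{W_K}(h) = Σ_{J ⊆ K} (-1)^{|J|} Ind_{W_J}^{W_K}(Res_{W_J} h). Then restriction commutes with duality: Res_{W_K}(D_W(f)) = D_{W_K}(Res_{W_K} f) for every class function f on W. (This is the finite Coxeter analogue of the commutation Res ∘ D_{R̃_σ,χ_σ} = D_{R̃^L_σ,χ_σ} ∘ Res established in the paper's Theorem 3.2(1).) -/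
open scoped Classical

namespace CoxDual
open CoxeterSystem

variable {B : Type*} {W : Type*} [Group W] {M : CoxeterMatrix B} (cs : CoxeterSystem M W)

/-- the reflection cocycle action -/
noncomputable def sig (i : B) : Function.End (W × ZMod 2) := fun p =>
  (cs.simple i * p.1 * cs.simple i, p.2 + if p.1 = cs.simple i then 1 else 0)

lemma sig_pow (i j : B) (n : ℕ) (p : W × ZMod 2) :
    ((sig cs i * sig cs j) ^ n) p =
      ((cs.simple i * cs.simple j) ^ n * p.1 * ((cs.simple i * cs.simple j) ^ n)⁻¹,
        p.2 + ∑ k ∈ Finset.range (2 * n),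
          if p.1 = cs.simple j * (cs.simple i * cs.simple j) ^ k then 1 else 0) := by
  have hj : cs.simple j * cs.simple j = 1 := cs.simple_mul_simple_self j
  have hi : cs.simple i * cs.simple i = 1 := cs.simple_mul_simple_self i
  have hj' : (cs.simple j)⁻¹ = cs.simple j := cs.inv_simple j
  have hi' : (cs.simple i)⁻¹ = cs.simple i := cs.inv_simple i
  have hconj : ∀ k : ℕ, ((cs.simple i * cs.simple j) ^ k)⁻¹ * cs.simple j
      = cs.simple j * (cs.simple i * cs.simple j) ^ k := by
    intro k
    induction k with
    | zero => simp
    | succ k ih =>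
      rw [pow_succ, mul_inv_rev, mul_assoc, ih, ← pow_succ, pow_succ', mul_inv_rev, hi', hj']
      simp only [mul_assoc]
  induction n with
  | zero => simp; rfl
  | succ n ih =>
    rw [pow_succ']
    change sig cs i (sig cs j (((sig cs i * sig cs j) ^ n) p)) = _
    rw [ih]
    have hc := hconj n
    have hcomm : (cs.simple i * cs.simple j) ^ n * (cs.simple i * cs.simple j)
      = cs.simple i * cs.simple j * (cs.simple i * cs.simple j) ^ n := by
      rw [← pow_succ, ← pow_succ']
    rw [show 2 * (n + 1) = 2 * n + 1 + 1 by ring, Finset.sum_range_succ, Finset.sum_range_succ,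
      pow_succ' _ n, show 2 * n + 1 = n + 1 + n by ring, show 2 * n = n + n by ring,
      pow_add _ (n+1) n, pow_succ' _ n, pow_add]
    generalize (cs.simple i * cs.simple j) ^ n = b at *
    simp only [sig, Prod.mk.injEq]
    refine ⟨by simp [mul_assoc], ?_⟩
    rw [add_assoc, add_assoc, add_assoc]
    congr 2
    congr 1
    · congr 1
      rw [← mul_assoc, ← hc]
      apply propext
      constructor
      · intro h; rw [← h]; group
      · intro h; rw [h]; group
    · congr 1
      apply propext
      have e : cs.simple j * (cs.simple i * cs.simple j * b * b)
          = b⁻¹ * (cs.simple j * cs.simple i * cs.simple j) * b := by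
        rw [← hcomm, mul_assoc (cs.simple j) (cs.simple i), ← mul_assoc b⁻¹, hc]
        simp only [mul_assoc]
      rw [e]
      constructor
      · intro h
        rw [← h]
        simp [mul_assoc]
      · intro h; rw [h]; simp [mul_assoc]

lemma sig_liftable : M.IsLiftable (sig cs) := by
  intro i j
  funext p
  rw [sig_pow]
  have h : (cs.simple i * cs.simple j) ^ M i j = 1 := cs.simple_mul_simple_pow i j
  rw [two_mul, Finset.sum_range_add]
  simp only [pow_add, h, one_mul, CharTwo.add_self_eq_zero]
  simp
  rfl

noncomputable def eta : W →* Function.End (W × ZMod 2) := cs.lift ⟨sig cs, sig_liftable cs⟩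

lemma eta_word (ω : List B) (t : W) :
    eta cs (cs.wordProd ω) (t, 0) =
      (cs.wordProd ω * t * (cs.wordProd ω)⁻¹, ((cs.rightInvSeq ω).count t : ZMod 2)) := by
  induction ω with
  | nil => simp; rfl
  | cons i ω ih =>
    rw [wordProd_cons, map_mul]
    change eta cs (cs.simple i) (eta cs (cs.wordProd ω) (t, 0)) = _
    rw [ih, eta, lift_apply_simple]
    simp only [sig, rightInvSeq, List.count_cons, Prod.mk.injEq]
    refine ⟨by simp [mul_assoc], ?_⟩
    push_cast
    congr 1
    have : (cs.wordProd ω * t * (cs.wordProd ω)⁻¹ = cs.simple i) ↔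
      ((cs.wordProd ω)⁻¹ * cs.simple i * cs.wordProd ω = t) := by
      constructor
      · intro h; rw [← h]; group
      · intro h; rw [← h]; group
    simp [this]

lemma exchange (ω : List B) (i : B) (h : cs.IsRightDescent (cs.wordProd ω) i) :
    ∃ k < ω.length, cs.wordProd ω * cs.simple i = cs.wordProd (ω.eraseIdx k) := by
  obtain ⟨α, hα, hα'⟩ := cs.exists_isReduced (cs.wordProd ω * cs.simple i)
  have hw : cs.wordProd (α.concat i) = cs.wordProd ω := by
    rw [wordProd_concat, ← hα']; simp
  have hred : cs.IsReduced (α.concat i) := by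
    rw [CoxeterSystem.IsReduced, hw, List.length_concat, ← hα.eq, ← hα']
    exact ((cs.isRightDescent_iff).1 h).symm
  have hmem : cs.simple i ∈ cs.rightInvSeq (α.concat i) := by
    rw [rightInvSeq_concat]; simp
  have h1 : (cs.rightInvSeq (α.concat i)).count (cs.simple i) = 1 :=
    List.count_eq_one_of_mem (hred.nodup_rightInvSeq) hmem
  have e1 := eta_word cs (α.concat i) (cs.simple i)
  rw [hw, eta_word, h1] at e1
  have e2 := congrArg Prod.snd e1
  have hm : cs.simple i ∈ cs.rightInvSeq ω := by
    by_contra hn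
    rw [List.count_eq_zero_of_not_mem hn] at e2
    simp at e2
  obtain ⟨k, hk, hk'⟩ := List.mem_iff_getElem.mp hm
  refine ⟨k, by simpa using hk, ?_⟩
  rw [← wordProd_mul_getD_rightInvSeq, List.getD_eq_getElem _ _ hk, hk']

/-- standard parabolic -/
abbrev PJ (J : Finset B) : Subgroup W := Subgroup.closure (cs.simple '' ↑J)

lemma simple_mem {J : Finset B} {i : B} (h : i ∈ J) : cs.simple i ∈ PJ cs J :=
  Subgroup.subset_closure ⟨i, h, rfl⟩

lemma word_mem {J : Finset B} (ω : List B) (h : ∀ i ∈ ω, i ∈ J) : cs.wordProd ω ∈ PJ cs J := by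
  induction ω with
  | nil => simp
  | cons i ω ih =>
    rw [wordProd_cons]
    exact mul_mem (simple_mem cs (h i (by simp))) (ih fun j hj => h j (by simp [hj]))

lemma exists_word {J : Finset B} {u : W} (hu : u ∈ PJ cs J) :
    ∃ ω : List B, (∀ i ∈ ω, i ∈ J) ∧ cs.wordProd ω = u := by
  induction hu using Subgroup.closure_induction with
  | mem x hx =>
    obtain ⟨i, hi, rfl⟩ := hx
    exact ⟨[i], by simpa using hi, by simp⟩
  | one => exact ⟨[], by simp, by simp⟩
  | mul x y _ _ hx hy =>
    obtain ⟨a, ha, rfl⟩ := hx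
    obtain ⟨b, hb, rfl⟩ := hy
    refine ⟨a ++ b, ?_, cs.wordProd_append _ _⟩
    intro i hi
    rcases List.mem_append.1 hi with h | h
    · exact ha i h
    · exact hb i h
  | inv x _ hx =>
    obtain ⟨a, ha, rfl⟩ := hx
    exact ⟨a.reverse, by simpa using ha, by simp⟩

/-- minimal among `J`-words -/
def JRed (J : Finset B) (ω : List B) : Prop := (∀ i ∈ ω, i ∈ J) ∧
  ∀ α : List B, (∀ i ∈ α, i ∈ J) → cs.wordProd α = cs.wordProd ω → ω.length ≤ α.length

lemma exists_JRed {J : Finset B} {u : W} (hu : u ∈ PJ cs J) :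
    ∃ ω : List B, JRed cs J ω ∧ cs.wordProd ω = u := by
  have hne : {ω : List B | (∀ i ∈ ω, i ∈ J) ∧ cs.wordProd ω = u}.Nonempty := exists_word cs hu
  obtain ⟨ω, hω, hmin⟩ := WellFounded.has_min (measure List.length).wf _ hne
  refine ⟨ω, ⟨hω.1, fun α hα hα' => ?_⟩, hω.2⟩
  exact not_lt.1 (hmin α ⟨hα, hα'.trans hω.2⟩)

lemma length_min_mul {J : Finset B} {y : W}
    (hy : ∀ u ∈ PJ cs J, cs.length y ≤ cs.length (y * u)) (ω : List B) (hω : JRed cs J ω) :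
    cs.length (y * cs.wordProd ω) = cs.length y + ω.length := by
  induction ω using List.reverseRecOn with
  | nil => simp
  | append_singleton ω i ih =>
    have hi : i ∈ J := hω.1 i (by simp)
    have hJ : ∀ j ∈ ω, j ∈ J := fun j hj => hω.1 j (by simp [hj])
    have hω' : JRed cs J ω := by
      refine ⟨hJ, fun α hα hα' => ?_⟩
      have := hω.2 (α ++ [i]) (by
        intro j hj
        rcases List.mem_append.1 hj with h | h
        · exact hα j h
        · rw [List.mem_singleton.1 h]; exact hi) (by rw [wordProd_append, hα', wordProd_append])
      simpa using this
    have ih := ih hω'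
    obtain ⟨α, hα, hα'⟩ := cs.exists_isReduced y
    rw [wordProd_append, wordProd_singleton, ← mul_assoc, List.length_append, List.length_singleton,
      ← add_assoc, ← ih]
    by_contra hne
    have hd : cs.IsRightDescent (cs.wordProd (α ++ ω)) i := by
      rw [wordProd_append, ← hα', cs.isRightDescent_iff]
      exact (cs.length_mul_simple _ i).resolve_left hne
    obtain ⟨k, hk, he⟩ := exchange cs _ _ hd
    rw [wordProd_append, ← hα'] at he
    by_cases hlt : k < α.length
    · rw [List.eraseIdx_append_of_lt_length hlt, wordProd_append] at he
      have h2 : cs.wordProd (α.eraseIdx k) =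
          y * (cs.wordProd ω * cs.simple i * (cs.wordProd ω)⁻¹) := by
        rw [← mul_assoc, ← mul_assoc, he]; group
      have h3 := hy _ (mul_mem (mul_mem (word_mem cs ω hJ) (simple_mem cs hi))
        (inv_mem (word_mem cs ω hJ)))
      rw [← h2] at h3
      have h4 := cs.length_wordProd_le (α.eraseIdx k)
      have h5 := List.length_eraseIdx_add_one hlt
      have h6 := hα.eq
      rw [← hα'] at h6
      omega
    · push Not at hlt
      rw [List.eraseIdx_append_of_length_le hlt, wordProd_append, ← hα', mul_assoc,
        mul_left_cancel_iff] at he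
      have h3 := hω.2 (ω.eraseIdx (k - α.length))
        (fun j hj => hJ j (List.mem_of_mem_eraseIdx hj))
        (by rw [← he, wordProd_append, wordProd_singleton])
      rw [List.length_append] at hk
      have h5 := List.length_eraseIdx_add_one (l := ω) (i := k - α.length) (by omega)
      simp at h3
      omega

lemma length_lt_of_asc {J : Finset B} {x : W}
    (hx : ∀ i ∈ J, cs.length x < cs.length (x * cs.simple i)) {u : W} (hu : u ∈ PJ cs J)
    (hne : u ≠ 1) : cs.length x < cs.length (x * u) := by
  obtain ⟨v, hv, hmin⟩ := WellFounded.has_min (measure (fun v => cs.length (x * v))).wf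
    {v | v ∈ PJ cs J} ⟨1, one_mem (PJ cs J)⟩
  have hy : ∀ u ∈ PJ cs J, cs.length (x * v) ≤ cs.length (x * v * u) := fun u hu => by
    rw [mul_assoc]
    exact not_lt.1 (hmin (v * u) (mul_mem hv hu))
  obtain ⟨ω, hω, hωv⟩ := exists_JRed cs (inv_mem hv)
  have hl := length_min_mul cs hy ω hω
  rw [hωv, mul_inv_cancel_right] at hl
  rcases List.eq_nil_or_concat ω with rfl | ⟨α, i, rfl⟩
  · have hv1 : v = 1 := by simpa using hωv.symm
    rw [hv1, mul_one] at hy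
    obtain ⟨β, hβ, rfl⟩ := exists_JRed cs hu
    rw [length_min_mul cs hy β hβ]
    have : β ≠ [] := by rintro rfl; simp at hne
    have := List.length_pos_iff.2 this
    omega
  · have hi : i ∈ J := hω.1 i (by simp)
    have h1 := hx i hi
    have h2 : x * cs.simple i = x * v * cs.wordProd α := by
      have : v⁻¹ = cs.wordProd α * cs.simple i := by
        rw [← hωv]; simp [wordProd_append]
      have h3 : v * cs.wordProd α = cs.simple i := by
        have : cs.wordProd α = v⁻¹ * cs.simple i := by rw [this]; simp
        rw [this]; group
      rw [mul_assoc, h3]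
    rw [h2] at h1
    have h3 := cs.length_mul_le (x * v) (cs.wordProd α)
    have h4 := cs.length_wordProd_le α
    simp at hl
    omega

end CoxDual
namespace CoxDual
open CoxeterSystem Matrix

section LinAlg
set_option linter.unusedSectionVars false
variable {B : Type*} {W : Type*} [Group W] [Fintype W] {M : CoxeterMatrix B}
  (cs : CoxeterSystem M W) (K : Finset B)

/-- ascents in `K` -/
noncomputable def Asc (x : W) : Finset B :=
  K.filter (fun i => cs.length x < cs.length (x * cs.simple i))

/-- the adapted basis -/
noncomputable def Pm : Matrix (PJ cs K) (PJ cs K) ℂ := fun y x =>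
  if (x : W)⁻¹ * (y : W) ∈ PJ cs (Asc cs K (x : W)) then 1 else 0

lemma Pm_self (x : PJ cs K) : Pm cs K x x = 1 := by simp [Pm]

lemma Pm_ne {y x : PJ cs K} (h : Pm cs K y x ≠ 0) :
    y = x ∨ cs.length (x : W) < cs.length (y : W) := by
  have hm : (x : W)⁻¹ * (y : W) ∈ PJ cs (Asc cs K (x : W)) := by
    by_contra hn; exact h (by simp [Pm, hn])
  by_cases h1 : (x : W)⁻¹ * (y : W) = 1
  · left; exact Subtype.ext (inv_mul_eq_one.1 h1).symm
  · right
    have := length_lt_of_asc cs (x := (x : W)) (fun i hi => (Finset.mem_filter.1 hi).2) hm h1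
    simpa using this

lemma Pm_eq_of {y z x : PJ cs K} {J : Finset B} (hJ : J ⊆ Asc cs K (x : W))
    (h : (y : W)⁻¹ * z ∈ PJ cs J) : Pm cs K y x = Pm cs K z x := by
  have hle : PJ cs J ≤ PJ cs (Asc cs K (x : W)) :=
    Subgroup.closure_mono (Set.image_mono (by exact_mod_cast hJ))
  have h' := hle h
  have e : (x : W)⁻¹ * z = (x : W)⁻¹ * y * ((y : W)⁻¹ * z) := by group
  unfold Pm
  rw [e, Subgroup.mul_mem_cancel_right _ h']

lemma Pm_inj (c : PJ cs K → ℂ) (hc : Pm cs K *ᵥ c = 0) : c = 0 := by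
  have key : ∀ n : ℕ, ∀ z : PJ cs K, cs.length (z : W) = n → c z = 0 := by
    intro n
    induction n using Nat.strong_induction_on with
    | _ n ih =>
      intro z hz
      have h := congrFun hc z
      rw [mulVec, dotProduct, Finset.sum_eq_single z] at h
      · simpa [Pm_self] using h
      · intro x _ hx
        by_cases h0 : Pm cs K z x = 0
        · simp [h0]
        · rcases Pm_ne cs K h0 with h1 | h1
          · exact absurd h1.symm hx
          · rw [ih _ (hz ▸ h1) x rfl, mul_zero]
      · simp
  funext z; exact key _ z rfl

lemma Pm_unit : IsUnit (Pm cs K) := by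
  rw [← mulVec_injective_iff_isUnit]
  intro a b hab
  have := Pm_inj cs K (a - b) (by rw [mulVec_sub]; exact sub_eq_zero.2 hab)
  exact sub_eq_zero.1 this

/-- simple generator as an element of `W_K` -/
def gen (i : B) (hi : i ∈ K) : PJ cs K := ⟨cs.simple i, simple_mem cs hi⟩

lemma coeff_zero (c : PJ cs K → ℂ) (i : B) (hi : i ∈ K)
    (hinv : ∀ y, (Pm cs K *ᵥ c) (y * gen cs K i hi) = (Pm cs K *ᵥ c) y) :
    ∀ z : PJ cs K, i ∉ Asc cs K (z : W) → c z = 0 := by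
  have key : ∀ n : ℕ, ∀ z : PJ cs K, cs.length (z : W) = n → i ∉ Asc cs K (z : W) → c z = 0 := by
    intro n
    induction n using Nat.strong_induction_on with
    | _ n ih =>
      intro z hz hiz
      have hlt : cs.length ((z * gen cs K i hi : PJ cs K) : W) < cs.length (z : W) := by
        have h1 : ¬ cs.length (z : W) < cs.length ((z : W) * cs.simple i) := fun h =>
          hiz (Finset.mem_filter.2 ⟨hi, h⟩)
        exact lt_of_le_of_ne (not_lt.1 h1) (cs.length_mul_simple_ne _ i)
      have h := hinv z
      rw [eq_comm, ← sub_eq_zero] at h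
      simp only [mulVec, dotProduct] at h
      rw [← Finset.sum_sub_distrib, Finset.sum_eq_single z] at h
      · have h0 : Pm cs K (z * gen cs K i hi) z = 0 := by
          by_contra hne
          rcases Pm_ne cs K hne with h1 | h1
          · rw [h1] at hlt; exact lt_irrefl _ hlt
          · exact lt_asymm h1 hlt
        simpa [Pm_self, h0] using h
      · intro x _ hx
        by_cases hix : i ∈ Asc cs K (x : W)
        · rw [Pm_eq_of cs K (y := z) (z := z * gen cs K i hi) (J := {i}) (by simpa using hix),
            sub_self]
          simpa [gen] using simple_mem cs (J := {i}) (i := i) (by simp)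
        · by_cases hl : cs.length (x : W) < cs.length (z : W)
          · rw [ih _ (hz ▸ hl) x rfl hix]; simp
          · have h1 : Pm cs K z x = 0 := by
              by_contra hne
              rcases Pm_ne cs K hne with h1 | h1
              · exact hx h1.symm
              · exact hl h1
            have h2 : Pm cs K (z * gen cs K i hi) x = 0 := by
              by_contra hne
              rcases Pm_ne cs K hne with h1 | h1
              · rw [h1] at hlt; exact hl hlt
              · exact hl (h1.trans hlt)
            simp [h1, h2]
      · simp
  exact fun z => key _ z rfl

lemma Q_mul : (Pm cs K)⁻¹ * Pm cs K = 1 :=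
  nonsing_inv_mul _ ((isUnit_iff_isUnit_det _).1 (Pm_unit cs K))

lemma mul_Q : Pm cs K * (Pm cs K)⁻¹ = 1 :=
  mul_nonsing_inv _ ((isUnit_iff_isUnit_det _).1 (Pm_unit cs K))

lemma Q_zero (v : PJ cs K → ℂ) (i : B) (hi : i ∈ K)
    (hinv : ∀ y, v (y * gen cs K i hi) = v y) (z : PJ cs K) (hz : i ∉ Asc cs K (z : W)) :
    ((Pm cs K)⁻¹ *ᵥ v) z = 0 := by
  refine coeff_zero cs K ((Pm cs K)⁻¹ *ᵥ v) i hi ?_ z hz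
  rw [mulVec_mulVec, mul_Q, one_mulVec]
  exact hinv

/-- left translation -/
noncomputable def Lm (w : PJ cs K) : Matrix (PJ cs K) (PJ cs K) ℂ := fun y z =>
  if z = w⁻¹ * y then 1 else 0

lemma Lm_mul (w : PJ cs K) (N : Matrix (PJ cs K) (PJ cs K) ℂ) (y z) :
    (Lm cs K w * N) y z = N (w⁻¹ * y) z := by
  simp [Matrix.mul_apply, Lm]

/-- averaging -/
noncomputable def Em (J : Finset B) : Matrix (PJ cs K) (PJ cs K) ℂ := fun y z =>
  (Nat.card (PJ cs J) : ℂ)⁻¹ * if (y : W)⁻¹ * (z : W) ∈ PJ cs J then 1 else 0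

lemma card_sum {J : Finset B} (hJ : J ⊆ K) (y : PJ cs K) :
    ∑ z : PJ cs K, (if (y : W)⁻¹ * (z : W) ∈ PJ cs J then (1 : ℂ) else 0)
      = Nat.card (PJ cs J) := by
  have hle : PJ cs J ≤ PJ cs K :=
    Subgroup.closure_mono (Set.image_mono (by exact_mod_cast hJ))
  rw [← Equiv.sum_comp (Equiv.mulLeft y)]
  simp only [Equiv.coe_mulLeft, Subgroup.coe_mul, inv_mul_cancel_left]
  rw [Finset.sum_boole, ← Nat.card_congr (Subgroup.subgroupOfEquivOfLe hle).toEquiv,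
    Nat.card_eq_fintype_card, Fintype.card_subtype]
  simp only [Subgroup.mem_subgroupOf]

lemma Em_mul_Pm {J : Finset B} (hJ : J ⊆ K) (x y : PJ cs K) (hx : J ⊆ Asc cs K (x : W)) :
    (Em cs K J * Pm cs K) y x = Pm cs K y x := by
  have : (Em cs K J * Pm cs K) y x = ∑ z : PJ cs K, ((Nat.card (PJ cs J) : ℂ)⁻¹ *
      if (y : W)⁻¹ * (z : W) ∈ PJ cs J then 1 else 0) * Pm cs K y x := by
    rw [Matrix.mul_apply]
    refine Finset.sum_congr rfl fun z _ => ?_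
    unfold Em
    split_ifs with h
    · rw [Pm_eq_of cs K hx h]
    · simp
  rw [this, ← Finset.sum_mul, ← Finset.mul_sum, card_sum cs K hJ, inv_mul_cancel₀, one_mul]
  exact_mod_cast Nat.card_pos.ne'

lemma trace_eq {J : Finset B} (hJ : J ⊆ K) (w : PJ cs K) :
    (Nat.card (PJ cs J) : ℂ)⁻¹ *
      ∑ x : PJ cs K, (if (x : W)⁻¹ * (w : W) * (x : W) ∈ PJ cs J then (1 : ℂ) else 0) =
    ∑ x : PJ cs K, if J ⊆ Asc cs K (x : W) then
      ((Pm cs K)⁻¹ * (Lm cs K w * Pm cs K)) x x else 0 := by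
  have h1 : (Nat.card (PJ cs J) : ℂ)⁻¹ *
      ∑ x : PJ cs K, (if (x : W)⁻¹ * (w : W) * (x : W) ∈ PJ cs J then (1 : ℂ) else 0)
      = trace (Lm cs K w * Em cs K J) := by
    rw [trace, Finset.mul_sum, ← Equiv.sum_comp (Equiv.mulLeft w⁻¹)
      (fun x : PJ cs K => (Nat.card (PJ cs J) : ℂ)⁻¹ *
        (if (x : W)⁻¹ * (w : W) * (x : W) ∈ PJ cs J then (1 : ℂ) else 0))]
    refine Finset.sum_congr rfl fun x _ => ?_
    rw [diag_apply, Lm_mul, Em]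
    simp [mul_assoc]
  set A := (Pm cs K)⁻¹ * (Lm cs K w * Pm cs K) with hA
  set F := (Pm cs K)⁻¹ * (Em cs K J * Pm cs K) with hF
  have h2 : trace (Lm cs K w * Em cs K J) = trace (A * F) := by
    have : A * F = (Pm cs K)⁻¹ * (Lm cs K w * Em cs K J * Pm cs K) := by
      rw [hA, hF]
      calc _ = (Pm cs K)⁻¹ * Lm cs K w * (Pm cs K * (Pm cs K)⁻¹) * Em cs K J * Pm cs K := by
            simp only [Matrix.mul_assoc]
        _ = _ := by rw [mul_Q]; simp only [Matrix.mul_assoc, Matrix.mul_one]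
    rw [this, trace_mul_comm (Pm cs K)⁻¹, Matrix.mul_assoc, mul_Q, Matrix.mul_one]
  have hF0 : ∀ z x : PJ cs K, ¬ J ⊆ Asc cs K (z : W) → F z x = 0 := by
    intro z x hz
    obtain ⟨i, hi, hiz⟩ := Finset.not_subset.1 hz
    refine Q_zero cs K (fun y => (Em cs K J * Pm cs K) y x) i (hJ hi) ?_ z hiz
    intro y
    simp only [Matrix.mul_apply]
    refine Finset.sum_congr rfl fun t _ => ?_
    congr 1
    unfold Em
    have e : ((y * gen cs K i (hJ hi) : PJ cs K) : W)⁻¹ * t =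
      cs.simple i * ((y : W)⁻¹ * t) := by simp [gen, mul_assoc]
    rw [e, Subgroup.mul_mem_cancel_left _ (simple_mem cs hi)]
  have hF1 : ∀ z x : PJ cs K, J ⊆ Asc cs K (x : W) → F z x = if z = x then 1 else 0 := by
    intro z x hx
    rw [← Matrix.one_apply, ← Q_mul cs K, hF, Matrix.mul_apply, Matrix.mul_apply]
    refine Finset.sum_congr rfl fun t _ => ?_
    rw [Em_mul_Pm cs K hJ x t hx]
  have hA0 : ∀ x z : PJ cs K, J ⊆ Asc cs K (z : W) → ¬ J ⊆ Asc cs K (x : W) → A x z = 0 := by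
    intro x z hz hx
    obtain ⟨i, hi, hix⟩ := Finset.not_subset.1 hx
    refine Q_zero cs K (fun y => (Lm cs K w * Pm cs K) y z) i (hJ hi) ?_ x hix
    intro y
    simp only [Lm_mul]
    refine (Pm_eq_of cs K (J := J) hz ?_).symm
    simpa [gen, mul_assoc] using simple_mem cs hi
  rw [h1, h2, trace]
  refine Finset.sum_congr rfl fun x _ => ?_
  rw [diag_apply, Matrix.mul_apply]
  split_ifs with hx
  · rw [Finset.sum_eq_single x]
    · rw [hF1 x x hx]; simp
    · intro z _ hz
      rw [hF1 z x hx, if_neg hz, mul_zero]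
    · simp
  · refine Finset.sum_eq_zero fun z _ => ?_
    by_cases hz : J ⊆ Asc cs K (z : W)
    · rw [hA0 x z hz hx, zero_mul]
    · rw [hF0 z x hz, mul_zero]

/-- sign -/
noncomputable def eps (w : W) : ℂ := (-1) ^ cs.length w

lemma eps_mul (a b : W) : eps cs (a * b) = eps cs a * eps cs b := by
  unfold eps
  rw [← pow_add, neg_one_pow_eq_pow_mod_two, cs.length_mul_mod_two, ← neg_one_pow_eq_pow_mod_two]

lemma eps_simple (i : B) : eps cs (cs.simple i) = -1 := by simp [eps]

lemma eps_sq (a : W) : eps cs a * eps cs a = 1 := by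
  unfold eps; rw [← mul_pow]; simp

lemma Pm_top {x : PJ cs K} (hx : Asc cs K (x : W) = ∅) (y : PJ cs K) :
    Pm cs K y x = if y = x then 1 else 0 := by
  unfold Pm
  rw [hx]
  congr 1
  simp only [PJ, Finset.coe_empty, Set.image_empty, Subgroup.closure_empty, Subgroup.mem_bot,
    inv_mul_eq_one, eq_iff_iff]
  rw [Subtype.ext_iff, eq_comm]

lemma Q_sign {x : PJ cs K} (hx : Asc cs K (x : W) = ∅) (y : PJ cs K) :
    (Pm cs K)⁻¹ x y * eps cs (y : W) = (Pm cs K)⁻¹ x 1 := by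
  have step : ∀ (y : PJ cs K) (i : B) (hi : i ∈ K),
      (Pm cs K)⁻¹ x (y * gen cs K i hi) = - (Pm cs K)⁻¹ x y := by
    intro y i hi
    have hg : gen cs K i hi * gen cs K i hi = 1 := by
      apply Subtype.ext; simp [gen]
    have h := Q_zero cs K (Pi.single y 1 + Pi.single (y * gen cs K i hi) 1) i hi (by
      intro t
      have e1 : (t * gen cs K i hi = y) ↔ (t = y * gen cs K i hi) := by
        constructor
        · rintro rfl; rw [mul_assoc, hg, mul_one]
        · rintro rfl; rw [mul_assoc, hg, mul_one]
      simp only [Pi.add_apply, Pi.single_apply, e1, mul_left_inj]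
      rw [add_comm]) x (by simp [hx])
    rw [mulVec_add] at h
    simp at h
    exact eq_neg_of_add_eq_zero_right h
  have key : ∀ (ω : List B) (hω : ∀ i ∈ ω, i ∈ K),
      (Pm cs K)⁻¹ x ⟨cs.wordProd ω, word_mem cs ω hω⟩ * eps cs (cs.wordProd ω)
        = (Pm cs K)⁻¹ x 1 := by
    intro ω
    induction ω using List.reverseRecOn with
    | nil =>
      intro hω
      have : (⟨cs.wordProd [], word_mem cs [] hω⟩ : PJ cs K) = 1 := Subtype.ext (by simp)
      rw [this]; simp [eps]
    | append_singleton ω i ih =>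
      intro hω
      have hi : i ∈ K := hω i (by simp)
      have hω' : ∀ i ∈ ω, i ∈ K := fun j hj => hω j (by simp [hj])
      have e : (⟨cs.wordProd (ω ++ [i]), word_mem cs _ hω⟩ : PJ cs K) =
        ⟨cs.wordProd ω, word_mem cs ω hω'⟩ * gen cs K i hi :=
        Subtype.ext (by simp [gen, wordProd_append])
      rw [e, step, wordProd_append, wordProd_singleton, eps_mul, eps_simple, ← ih hω']
      ring
  obtain ⟨ω, hω, hy⟩ := exists_word cs y.2
  have := key ω hω
  have e : (⟨cs.wordProd ω, word_mem cs ω hω⟩ : PJ cs K) = y := Subtype.ext hy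
  rw [e, hy] at this
  exact this

lemma Q_top {x x' : PJ cs K} (hx' : Asc cs K (x' : W) = ∅) :
    (Pm cs K)⁻¹ x x' = if x = x' then 1 else 0 := by
  rw [← Matrix.one_apply, ← Q_mul cs K, Matrix.mul_apply]
  simp [Pm_top cs K hx']

lemma diag_top {x : PJ cs K} (hx : Asc cs K (x : W) = ∅) (w : PJ cs K) :
    ((Pm cs K)⁻¹ * (Lm cs K w * Pm cs K)) x x = eps cs (w : W) := by
  have h1 : ((Pm cs K)⁻¹ * (Lm cs K w * Pm cs K)) x x = (Pm cs K)⁻¹ x (w * x) := by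
    rw [Matrix.mul_apply]
    simp only [Lm_mul, Pm_top cs K hx, inv_mul_eq_iff_eq_mul]
    simp
  rw [h1]
  have h2 := Q_sign cs K hx (w * x)
  rw [← Q_sign cs K hx x, Q_top cs K hx, if_pos rfl, one_mul, Subgroup.coe_mul, eps_mul] at h2
  have hs := eps_sq cs (x : W)
  have hw := eps_sq cs (w : W)
  calc (Pm cs K)⁻¹ x (w * x) = (Pm cs K)⁻¹ x (w * x) * (eps cs (w:W) * eps cs (w:W))
        * (eps cs (x:W) * eps cs (x:W)) := by rw [hs, hw]; ring
    _ = ((Pm cs K)⁻¹ x (w * x) * (eps cs (w:W) * eps cs (x:W))) * eps cs (x:W) * eps cs (w:W) := by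
        ring
    _ = eps cs (w : W) := by rw [h2, hs, one_mul]

lemma exists_top : ∃ x : PJ cs K, ∀ y : PJ cs K, Asc cs K (y : W) = ∅ ↔ y = x := by
  obtain ⟨x, hx⟩ := Finite.exists_max (fun x : PJ cs K => cs.length (x : W))
  have hx0 : Asc cs K (x : W) = ∅ := by
    rw [Asc, Finset.filter_eq_empty_iff]
    intro i hi
    exact not_lt.2 (hx (x * gen cs K i hi))
  refine ⟨x, fun y => ⟨fun hy => ?_, fun h => h ▸ hx0⟩⟩
  by_contra hne
  have h1 := Q_sign cs K hx0 y
  rw [← Q_sign cs K hx0 x, Q_top cs K hx0, if_pos rfl, Q_top cs K hy, if_neg (Ne.symm hne)] at h1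
  have := eps_sq cs (x : W)
  rw [zero_mul, one_mul] at h1
  rw [← h1] at this
  simp at this

lemma solomon (w : PJ cs K) :
    ∑ J ∈ K.powerset, (-1 : ℂ) ^ J.card * ((Nat.card (PJ cs J) : ℂ)⁻¹ *
      ∑ x : PJ cs K, (if (x : W)⁻¹ * (w : W) * (x : W) ∈ PJ cs J then (1 : ℂ) else 0))
      = eps cs (w : W) := by
  have h1 : ∀ J ∈ K.powerset, (-1 : ℂ) ^ J.card * ((Nat.card (PJ cs J) : ℂ)⁻¹ *
      ∑ x : PJ cs K, (if (x : W)⁻¹ * (w : W) * (x : W) ∈ PJ cs J then (1 : ℂ) else 0))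
      = ∑ x : PJ cs K, if J ⊆ Asc cs K (x : W) then
      (-1 : ℂ) ^ J.card * ((Pm cs K)⁻¹ * (Lm cs K w * Pm cs K)) x x else 0 := by
    intro J hJ
    rw [trace_eq cs K (Finset.mem_powerset.1 hJ), Finset.mul_sum]
    simp only [mul_ite, mul_zero]
  rw [Finset.sum_congr rfl h1, Finset.sum_comm]
  obtain ⟨x₀, hx₀⟩ := exists_top cs K
  have h2 : ∀ x : PJ cs K, (∑ J ∈ K.powerset, if J ⊆ Asc cs K (x : W) then
      (-1 : ℂ) ^ J.card * ((Pm cs K)⁻¹ * (Lm cs K w * Pm cs K)) x x else 0)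
      = if x = x₀ then eps cs (w : W) else 0 := by
    intro x
    have e : K.powerset.filter (fun J => J ⊆ Asc cs K (x : W)) = (Asc cs K (x : W)).powerset := by
      ext J
      simp only [Finset.mem_filter, Finset.mem_powerset, and_iff_right_iff_imp]
      exact fun h => h.trans (Finset.filter_subset _ _)
    rw [← Finset.sum_filter, e, ← Finset.sum_mul]
    have hs : ∑ J ∈ (Asc cs K (x : W)).powerset, (-1 : ℂ) ^ J.card =
        if Asc cs K (x : W) = ∅ then 1 else 0 := by
      have := Finset.sum_powerset_neg_one_pow_card (x := Asc cs K (x : W))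
      have h := congrArg (Int.cast : ℤ → ℂ) this
      push_cast at h
      exact h
    rw [hs]
    by_cases hx : Asc cs K (x : W) = ∅
    · rw [if_pos hx, if_pos ((hx₀ x).1 hx), one_mul, diag_top cs K hx]
    · rw [if_neg hx, if_neg (fun h => hx ((hx₀ x).2 h)), zero_mul]
  rw [Finset.sum_congr rfl fun x _ => h2 x]
  simp

end LinAlg

lemma dual_eq {B : Type*} [DecidableEq B] [Fintype B]
    {W : Type*} [Group W] [Fintype W] {M : CoxeterMatrix B} (cs : CoxeterSystem M W)
    (K : Finset B) (f : W → ℂ) (hf : ∀ x w : W, f (x⁻¹ * w * x) = f w) (w : W)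
    (hw : w ∈ PJ cs K) : dualCF cs (PJ cs K) K f w = f w * eps cs w := by
  rw [← solomon cs K ⟨w, hw⟩, dualCF, Finset.mul_sum]
  refine Finset.sum_congr rfl fun J _ => ?_
  unfold indCF
  rw [mul_left_comm (f w), mul_left_comm (f w), Finset.mul_sum _ _ (f w)]
  congr 2
  apply Finset.sum_congr rfl
  intro x _
  rw [hf]
  simp

end CoxDual

/-- Restriction to a standard parabolic subgroup `W_K` commutes with the duality operators:
`Res_{W_K} (D_W f) = D_{W_K} (Res_{W_K} f)` for every class function `f` on the finite
Coxeter group `(W, S)`, i.e. the two sides agree at every `w ∈ W_K`. -/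
theorem res_dualCF_comm
    {B : Type*} [DecidableEq B] [Fintype B]
    {W : Type*} [Group W] [Fintype W]
    {M : CoxeterMatrix B} (cs : CoxeterSystem M W) (K : Finset B)
    (f : W → ℂ) (hf : ∀ x w : W, f (x⁻¹ * w * x) = f w) :
    ∀ w ∈ Subgroup.closure (cs.simple '' ↑K),
      dualCF cs ⊤ Finset.univ f w =
        dualCF cs (Subgroup.closure (cs.simple '' ↑K)) K f w := by
  intro w hw
  have htop : (⊤ : Subgroup W) = CoxDual.PJ cs Finset.univ := by
    rw [CoxDual.PJ, Finset.coe_univ, Set.image_univ, cs.subgroup_closure_range_simple]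
  rw [htop, CoxDual.dual_eq cs Finset.univ f hf w (htop ▸ Subgroup.mem_top w)]
  exact (CoxDual.dual_eq cs K f hf w hw).symm
end

section
/- Let (W, S) be a Coxeter system with W a finite group and S finite, and let K ⊆ S. Define the duality operator on class functions of W by D_W(f) = Σ_{J ⊆ S} (-1)^{|J|} Ind_{W_J}^W(Res_{W_J} f), and on class functions of W_K by D_{W_K}(h) = Σ_{J ⊆ K} (-1)^{|J|} Ind_{W_J}^{W_K}(Res_{W_J} h). Then induction commutes with duality: D_W(Ind_{W_K}^W h) = Ind_{W_K}^W(D_{W_K} h) for every class function h on W_K. (This is the finite Coxeter analogue of the commutation D_{R̃_σ,χ_σ} ∘ Ind = Ind ∘ D_{R̃^L_σ,χ_σ} established in the paper's Theorem 3.2(1).) -/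
open scoped Classical

section CoxComb

variable {B : Type*} {W : Type*} [Group W] {M : CoxeterMatrix B} (cs : CoxeterSystem M W)

/-- Tits' action of a simple reflection. -/
noncomputable def rhoS (i : B) : Function.End (W × ZMod 2) := fun p =>
  (cs.simple i * p.1 * cs.simple i, p.2 + if p.1 = cs.simple i then 1 else 0)

theorem simple_mul_pow (i j : B) (k : ℕ) :
    cs.simple j * (cs.simple i * cs.simple j) ^ k =
      ((cs.simple i * cs.simple j) ^ k)⁻¹ * cs.simple j := by
  have h : SemiconjBy (cs.simple j) (cs.simple i * cs.simple j)
      (cs.simple i * cs.simple j)⁻¹ := by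
    simp [SemiconjBy, mul_assoc]
  have h2 := (h.pow_right k).eq
  rwa [inv_pow] at h2

theorem rhoS_pow (i j : B) (k : ℕ) (t : W) (e : ZMod 2) :
    ((rhoS cs i * rhoS cs j) ^ k) (t, e) =
      ((cs.simple i * cs.simple j) ^ k * t * ((cs.simple i * cs.simple j) ^ k)⁻¹,
        e + ∑ l ∈ Finset.range (2 * k),
          if t = ((cs.simple i * cs.simple j) ^ l)⁻¹ * cs.simple j then 1 else 0) := by
  induction k with
  | zero => simp; rfl
  | succ k ih =>
    have h1 : ∀ a b c : W, a * b * a⁻¹ = c ↔ b = a⁻¹ * c * a := by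
      intro a b c
      constructor
      · rintro rfl; group
      · rintro rfl; group
    have hk := simple_mul_pow cs i j k
    rw [pow_succ']
    change (rhoS cs i * rhoS cs j) (((rhoS cs i * rhoS cs j) ^ k) (t, e)) = _
    rw [ih]
    change rhoS cs i (rhoS cs j _) = _
    simp only [rhoS]
    rw [show 2 * (k + 1) = 2 * k + 1 + 1 by ring, Finset.sum_range_succ, Finset.sum_range_succ]
    set c := cs.simple i * cs.simple j with hc
    have hci : c⁻¹ = cs.simple j * cs.simple i := by simp [hc]
    have e1 : (c ^ k * t * (c ^ k)⁻¹ = cs.simple j) ↔ t = (c ^ (2 * k))⁻¹ * cs.simple j := by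
      rw [h1, mul_assoc, hk, two_mul, pow_add, mul_inv_rev, mul_assoc]
    have e2 : (cs.simple j * (c ^ k * t * (c ^ k)⁻¹) * cs.simple j = cs.simple i) ↔
        t = (c ^ (2 * k + 1))⁻¹ * cs.simple j := by
      have : (cs.simple j * (c ^ k * t * (c ^ k)⁻¹) * cs.simple j = cs.simple i) ↔
          c ^ k * t * (c ^ k)⁻¹ = cs.simple j * cs.simple i * cs.simple j := by
        constructor
        · intro h; rw [← h]; simp [mul_assoc]
        · intro h; rw [h]; simp [mul_assoc]
      rw [this, h1, ← hci, mul_assoc, mul_assoc, hk, 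
        show 2 * k + 1 = k + (1 + k) by ring, pow_add, pow_add]
      simp only [mul_inv_rev, mul_assoc, pow_one]
    refine Prod.ext ?_ ?_
    · simp only [pow_succ', mul_inv_rev, hci]
      simp [hc, mul_assoc]
    · simp only [e1, e2, add_assoc]

theorem rhoS_liftable : M.IsLiftable (rhoS cs) := by
  intro i j
  funext p
  obtain ⟨t, e⟩ := p
  rw [rhoS_pow, cs.simple_mul_simple_pow, two_mul, Finset.sum_range_add]
  simp only [pow_add, cs.simple_mul_simple_pow, one_mul]
  rw [CharTwo.add_self_eq_zero]
  simp
  rfl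

/-- Tits' action. -/
noncomputable def rhoW : W →* Function.End (W × ZMod 2) := cs.lift ⟨rhoS cs, rhoS_liftable cs⟩

theorem rhoW_simple (i : B) : rhoW cs (cs.simple i) = rhoS cs i :=
  cs.lift_apply_simple (rhoS_liftable cs) i

theorem rhoW_word (ω : List B) (t : W) (e : ZMod 2) :
    rhoW cs (cs.wordProd ω) (t, e) =
      (cs.wordProd ω * t * (cs.wordProd ω)⁻¹, e + ((cs.rightInvSeq ω).count t : ZMod 2)) := by
  induction ω with
  | nil => simp; rfl
  | cons i ω ih =>
    rw [cs.wordProd_cons, map_mul]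
    change rhoW cs (cs.simple i) (rhoW cs (cs.wordProd ω) (t, e)) = _
    rw [ih, rhoW_simple]
    simp only [rhoS, CoxeterSystem.rightInvSeq, List.count_cons]
    refine Prod.ext ?_ ?_
    · simp [mul_assoc]
    · have : (cs.wordProd ω * t * (cs.wordProd ω)⁻¹ = cs.simple i) ↔
        ((cs.wordProd ω)⁻¹ * cs.simple i * cs.wordProd ω = t) := by
        constructor
        · intro h; rw [← h]; group
        · intro h; rw [← h]; group
      simp only [this, beq_iff_eq]
      push_cast
      ring

/-- The reflection cocycle. -/
noncomputable def etaW (w t : W) : ZMod 2 := (rhoW cs w (t, 0)).2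

theorem etaW_word (ω : List B) (t : W) :
    etaW cs (cs.wordProd ω) t = ((cs.rightInvSeq ω).count t : ZMod 2) := by
  simp [etaW, rhoW_word]

theorem rhoW_apply (w t : W) (e : ZMod 2) :
    rhoW cs w (t, e) = (w * t * w⁻¹, e + etaW cs w t) := by
  obtain ⟨ω, rfl⟩ := cs.wordProd_surjective w
  rw [rhoW_word, etaW_word]

theorem etaW_mul (u w t : W) :
    etaW cs (u * w) t = etaW cs w t + etaW cs u (w * t * w⁻¹) := by
  have : rhoW cs (u * w) (t, 0) = rhoW cs u (rhoW cs w (t, 0)) := by rw [map_mul]; rfl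
  rw [rhoW_apply, rhoW_apply, rhoW_apply] at this
  simpa using congrArg Prod.snd this

theorem etaW_simple (i : B) : etaW cs (cs.simple i) (cs.simple i) = 1 := by
  simp [etaW, rhoW_simple, rhoS]

theorem mem_ris_of_eta {ω : List B} {t : W} (h : etaW cs (cs.wordProd ω) t = 1) :
    t ∈ cs.rightInvSeq ω := by
  rw [etaW_word] at h
  by_contra hn
  rw [List.count_eq_zero_of_not_mem hn] at h
  simp at h

theorem length_lt_of_eta {w t : W} (h : etaW cs w t = 1) : cs.length (w * t) < cs.length w := by
  obtain ⟨ω, hω, rfl⟩ := cs.exists_isReduced w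
  exact (cs.isRightInversion_of_mem_rightInvSeq hω (mem_ris_of_eta cs h)).2

theorem zmod2_cases (a : ZMod 2) : a = 0 ∨ a = 1 := by
  revert a; decide

theorem eta_simple_iff (w : W) (i : B) :
    etaW cs w (cs.simple i) = 1 ↔ cs.length (w * cs.simple i) < cs.length w := by
  refine ⟨length_lt_of_eta cs, fun h => ?_⟩
  rcases zmod2_cases (etaW cs w (cs.simple i)) with h0 | h0
  · have h1 : etaW cs (w * cs.simple i) (cs.simple i) = 1 := by
      rw [etaW_mul, etaW_simple]; simp [h0]
    have := length_lt_of_eta cs h1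
    simp at this
    omega
  · exact h0

/-- Standard parabolic subgroup. -/
def parW (J : Set B) : Subgroup W := Subgroup.closure (cs.simple '' J)

theorem exists_reduced_word (J : Set B) {y : W} (hy : y ∈ parW cs J) :
    ∃ ω : List B, cs.IsReduced ω ∧ (∀ i ∈ ω, i ∈ J) ∧ y = cs.wordProd ω := by
  have key : ∀ (y : W) (i : B), i ∈ J →
      (∃ ω : List B, cs.IsReduced ω ∧ (∀ i ∈ ω, i ∈ J) ∧ y = cs.wordProd ω) →
      ∃ ω : List B, cs.IsReduced ω ∧ (∀ i ∈ ω, i ∈ J) ∧ y * cs.simple i = cs.wordProd ω := by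
    rintro y i hi ⟨ω, hω, hJ, rfl⟩
    rcases cs.length_mul_simple (cs.wordProd ω) i with h | h
    · refine ⟨ω ++ [i], ?_, ?_, ?_⟩
      · rw [CoxeterSystem.IsReduced, cs.wordProd_append, cs.wordProd_singleton, h, hω.eq]; simp
      · intro k hk
        rw [List.mem_append, List.mem_singleton] at hk
        rcases hk with hk | rfl
        · exact hJ k hk
        · exact hi
      · simp [cs.wordProd_append]
    · have he : etaW cs (cs.wordProd ω) (cs.simple i) = 1 := by
        rw [eta_simple_iff]; omega
      obtain ⟨j, hj, hji⟩ := List.getElem_of_mem (mem_ris_of_eta cs he)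
      have h2 := cs.wordProd_mul_getD_rightInvSeq ω j
      rw [List.getD_eq_getElem _ _ hj, hji] at h2
      refine ⟨ω.eraseIdx j, ?_, ?_, h2⟩
      · rw [CoxeterSystem.IsReduced, ← h2, List.length_eraseIdx]
        rw [cs.length_rightInvSeq] at hj
        rw [hω.eq] at h
        simp [hj]; omega
      · intro k hk
        exact hJ k (List.mem_of_mem_eraseIdx hk)
  induction hy using Subgroup.closure_induction_right with
  | one => exact ⟨[], by simp [CoxeterSystem.IsReduced], by simp, by simp⟩
  | mul_right x hx y hy ih =>
    obtain ⟨i, hi, rfl⟩ := hy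
    exact key x i hi ih
  | mul_inv_cancel x hx y hy ih =>
    obtain ⟨i, hi, rfl⟩ := hy
    rw [cs.inv_simple]
    exact key x i hi ih

theorem min_unique (J : Set B) {x y : W} (hy : y ∈ parW cs J)
    (hmin : ∀ z ∈ parW cs J, cs.length x ≤ cs.length (x * z))
    (hasc : ∀ i ∈ J, cs.length (x * y) ≤ cs.length (x * y * cs.simple i)) : y = 1 := by
  obtain ⟨ω, hω, hJ, rfl⟩ := exists_reduced_word cs J hy
  rcases List.eq_nil_or_concat ω with rfl | ⟨ω', i, rfl⟩
  · simp
  exfalso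
  rw [List.concat_eq_append] at *
  have hi : i ∈ J := hJ i (by simp)
  set y := cs.wordProd (ω' ++ [i]) with hyd
  have hys : y * cs.simple i = cs.wordProd ω' := by
    rw [hyd, cs.wordProd_append]; simp
  have h1 : etaW cs y (cs.simple i) = 1 := by
    rw [eta_simple_iff, hys, hyd, hω.eq]
    have := cs.length_wordProd_le ω'
    simp; omega
  have h2 := etaW_mul cs x y (cs.simple i)
  have h3 : etaW cs x (y * cs.simple i * y⁻¹) = 0 := by
    rcases zmod2_cases (etaW cs x (y * cs.simple i * y⁻¹)) with h | h
    · exact h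
    · have h4 := length_lt_of_eta cs h
      have h5 := hmin (y * cs.simple i * y⁻¹)
        (mul_mem (mul_mem hy (Subgroup.subset_closure ⟨i, hi, rfl⟩)) (inv_mem hy))
      omega
  rw [h1, h3, add_zero, eta_simple_iff] at h2
  have := hasc i hi
  omega

theorem length_lt_coset (J : Set B) {x y : W} (hy : y ∈ parW cs J) (hy1 : y ≠ 1)
    (hasc : ∀ i ∈ J, cs.length x ≤ cs.length (x * cs.simple i)) :
    cs.length x < cs.length (x * y) := by
  obtain ⟨z, hz, hzmin⟩ := WellFounded.has_min
    (InvImage.wf (fun z => cs.length (x * z)) Nat.lt_wfRel.wf) (parW cs J : Set W) ⟨1, one_mem _⟩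
  have hzmin' : ∀ u ∈ parW cs J, cs.length (x * z) ≤ cs.length (x * u) := fun u hu =>
    not_lt.mp (hzmin u hu)
  have aux : ∀ z ∈ parW cs J, (∀ u ∈ parW cs J, cs.length (x * z) ≤ cs.length (x * u)) →
      z = 1 := by
    intro z hz hm
    have := min_unique cs J (x := x * z) (y := z⁻¹) (inv_mem hz)
      (fun u hu => by rw [mul_assoc]; exact hm _ (mul_mem hz hu))
      (by simpa using hasc)
    simpa using this
  have hz1 := aux z hz hzmin'
  subst hz1
  rw [mul_one] at hzmin'
  refine lt_of_le_of_ne (hzmin' y hy) fun he => hy1 (aux y hy ?_)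
  rw [← he]; exact hzmin'

end CoxComb
section Solomon

variable {B : Type*} {G : Type*} [Group G] [Fintype G]

/-- Right-invariant functions. -/
def rInv (P : Subgroup G) : Submodule ℂ (G → ℂ) where
  carrier := {f | ∀ x, ∀ y ∈ P, f (x * y) = f x}
  add_mem' := by intro f g hf hg x y hy; simp [hf x y hy, hg x y hy]
  zero_mem' := by intro x y _; simp
  smul_mem' := by intro c f hf x y hy; simp [hf x y hy]

/-- The ascent set. -/
noncomputable def ascS (s : B → G) (K : Finset B) (len : G → ℕ) (x : G) : Finset B :=
  K.filter fun i => len x < len (x * s i)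

/-- Coset indicator. -/
noncomputable def cosI (P : Subgroup G) (x : G) : G → ℂ := fun z => if x⁻¹ * z ∈ P then 1 else 0

/-- Left translation composed with right averaging. -/
noncomputable def avT (P : Subgroup G) (w : G) : (G → ℂ) →ₗ[ℂ] (G → ℂ) where
  toFun f := fun z => (Nat.card P : ℂ)⁻¹ * ∑ y : P, f (w⁻¹ * z * y)
  map_add' := by intro f g; funext z; simp [Finset.sum_add_distrib, mul_add]
  map_smul' := by intro c f; funext z; simp [← Finset.mul_sum]; ring

theorem cosI_mem {P Q : Subgroup G} (h : Q ≤ P) (x : G) : cosI P x ∈ rInv Q := by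
  intro z y hy
  simp only [cosI]
  rw [← mul_assoc, Subgroup.mul_mem_cancel_right _ (h hy)]

theorem avT_mem (P : Subgroup G) (w : G) (f : G → ℂ) : avT P w f ∈ rInv P := by
  intro z y hy
  simp only [avT, LinearMap.coe_mk, AddHom.coe_mk]
  congr 1
  refine Fintype.sum_equiv (Equiv.mulLeft (⟨y, hy⟩ : P)) _ _ fun u => ?_
  simp [mul_assoc]

theorem avT_of_mem {P : Subgroup G} (w : G) {f : G → ℂ} (hf : f ∈ rInv P) :
    avT P w f = fun z => f (w⁻¹ * z) := by
  funext z
  simp only [avT, LinearMap.coe_mk, AddHom.coe_mk]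
  have : ∀ y : P, f (w⁻¹ * z * y) = f (w⁻¹ * z) := fun y => hf _ _ y.2
  simp [this]

theorem trace_avT (P : Subgroup G) (w : G) :
    LinearMap.trace ℂ (G → ℂ) (avT P w) =
      (Nat.card P : ℂ)⁻¹ * ∑ x : G, if x⁻¹ * w * x ∈ P then 1 else 0 := by
  rw [LinearMap.trace_eq_matrix_trace ℂ (Pi.basisFun ℂ G), Matrix.trace, Finset.mul_sum]
  refine Finset.sum_congr rfl fun x _ => ?_
  rw [Matrix.diag_apply, LinearMap.toMatrix_apply]
  simp only [Pi.basisFun_repr, Pi.basisFun_apply, avT, LinearMap.coe_mk, AddHom.coe_mk]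
  congr 1
  have h1 : ∀ y : P, (Pi.single x (1 : ℂ) : G → ℂ) (w⁻¹ * x * y) =
      if (y : G) = x⁻¹ * w * x then 1 else 0 := by
    intro y
    rw [Pi.single_apply]
    have : (w⁻¹ * x * y = x) ↔ ((y : G) = x⁻¹ * w * x) := by
      constructor
      · intro h
        rw [mul_assoc, inv_mul_eq_iff_eq_mul] at h
        rw [mul_assoc, ← h]; group
      · intro h; rw [h]; group
    simp only [this]
  simp only [h1]
  split_ifs with h
  · rw [Finset.sum_eq_single (⟨_, h⟩ : P)]
    · simp
    · intro b _ hb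
      rw [if_neg]
      intro hb'
      exact hb (Subtype.ext hb')
    · simp
  · refine Finset.sum_eq_zero fun y _ => ?_
    rw [if_neg]
    intro hy
    exact h (hy ▸ y.2)

variable (s : B → G) (K : Finset B) (len : G → ℕ) (P : Finset B → Subgroup G)

/-- Adapted basis vectors. -/
noncomputable def adB (x : G) : G → ℂ := cosI (P (ascS s K len x)) x

variable {s K len P}

theorem adB_self (x : G) : adB s K len P x x = 1 := by simp [adB, cosI, one_mem]

theorem adB_ne (hlen : ∀ J ⊆ K, ∀ x, (∀ i ∈ J, len x ≤ len (x * s i)) → ∀ y ∈ P J, y ≠ 1 →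
      len x < len (x * y)) {x z : G} (hz : len z ≤ len x) (hne : z ≠ x) :
    adB s K len P x z = 0 := by
  rw [adB, cosI, if_neg]
  intro hm
  have := hlen (ascS s K len x) (Finset.filter_subset _ _) x
    (fun i hi => (Finset.mem_filter.mp hi).2.le) _ hm (by
      intro h1; rw [inv_mul_eq_one] at h1; exact hne h1.symm)
  simp at this
  omega

theorem rInv_le_span
    (hmem : ∀ J : Finset B, ∀ i ∈ J, s i ∈ P J)
    (hlen : ∀ J ⊆ K, ∀ x, (∀ i ∈ J, len x ≤ len (x * s i)) → ∀ y ∈ P J, y ≠ 1 →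
      len x < len (x * y))
    (hmono : ∀ J J' : Finset B, J ⊆ J' → P J ≤ P J')
    (hs : ∀ i ∈ K, ∀ x, len (x * s i) ≠ len x)
    {J : Finset B} (hJ : J ⊆ K) {f : G → ℂ} (hf : f ∈ rInv (P J)) :
    f ∈ Submodule.span ℂ (adB s K len P '' {x | J ⊆ ascS s K len x}) := by
  obtain ⟨N, hN⟩ : ∃ N, ∀ x, len x < N := by
    obtain ⟨N, hN⟩ := (Set.finite_range len).bddAbove
    exact ⟨N + 1, fun x => Nat.lt_succ_of_le (hN ⟨x, rfl⟩)⟩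
  have main : ∀ k : ℕ, ∀ f ∈ rInv (P J), (∀ x, f x ≠ 0 → N ≤ len x + k) →
      f ∈ Submodule.span ℂ (adB s K len P '' {x | J ⊆ ascS s K len x}) := by
    intro k
    induction k with
    | zero =>
      intro f _ h
      have : f = 0 := by
        funext x
        by_contra hx
        have := h x hx
        have := hN x
        omega
      rw [this]; exact zero_mem _
    | succ k ih =>
      intro f hf h
      set X : Finset G := Finset.univ.filter fun x => f x ≠ 0 ∧ len x + (k + 1) = N with hX
      have hXa : ∀ x ∈ X, J ⊆ ascS s K len x := by
        intro x hx i hi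
        obtain ⟨-, hx0, hxl⟩ := Finset.mem_filter.mp hx
        refine Finset.mem_filter.mpr ⟨hJ hi, ?_⟩
        have h1 : f (x * s i) = f x := hf x _ (hmem J i hi)
        have h2 := h (x * s i) (by rwa [h1])
        have h3 := hs i (hJ hi) x
        omega
      set g : G → ℂ := ∑ x ∈ X, f x • adB s K len P x with hg
      have hgs : g ∈ Submodule.span ℂ (adB s K len P '' {x | J ⊆ ascS s K len x}) :=
        Submodule.sum_mem _ fun x hx => Submodule.smul_mem _ _
          (Submodule.subset_span ⟨x, hXa x hx, rfl⟩)
      have hgi : g ∈ rInv (P J) :=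
        Submodule.sum_mem _ fun x hx => Submodule.smul_mem _ _
          (cosI_mem (hmono _ _ (hXa x hx)) x)
      have hd : f - g ∈ Submodule.span ℂ (adB s K len P '' {x | J ⊆ ascS s K len x}) := by
        refine ih _ (Submodule.sub_mem _ hf hgi) fun z hz => ?_
        by_contra hlt
        apply hz
        have hgz : g z = ∑ x ∈ X, f x * adB s K len P x z := by
          simp [hg, Finset.sum_apply]
        have hother : ∀ x ∈ X, x ≠ z → f x * adB s K len P x z = 0 := by
          intro x hx hxz
          obtain ⟨-, hx0, hxl⟩ := Finset.mem_filter.mp hx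
          rw [adB_ne hlen (by omega) hxz.symm, mul_zero]
        rw [Pi.sub_apply, hgz]
        by_cases hzX : z ∈ X
        · rw [Finset.sum_eq_single_of_mem z hzX hother, adB_self]; simp
        · rw [Finset.sum_eq_zero]
          · by_contra hfz
            rw [sub_zero] at hfz
            apply hzX
            have := h z hfz
            exact Finset.mem_filter.mpr ⟨Finset.mem_univ _, hfz, by omega⟩
          · intro x hx
            exact hother x hx (fun h => hzX (h ▸ hx))
      have := Submodule.add_mem _ hd hgs
      simpa using this
  exact main N f hf fun x _ => by omega

theorem solomon
    (ε : G →* ℂ)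
    (hε : ∀ i ∈ K, ε (s i) = -1)
    (hmem : ∀ J : Finset B, ∀ i ∈ J, s i ∈ P J)
    (hlen : ∀ J ⊆ K, ∀ x, (∀ i ∈ J, len x ≤ len (x * s i)) → ∀ y ∈ P J, y ≠ 1 →
      len x < len (x * y))
    (hmono : ∀ J J' : Finset B, J ⊆ J' → P J ≤ P J')
    (hs : ∀ i ∈ K, ∀ x, len (x * s i) ≠ len x)
    (hP0 : P ∅ = ⊥)
    (hP1 : ∀ i ∈ K, ∀ y ∈ P {i}, y = 1 ∨ y = s i)
    (hgen : Subgroup.closure (s '' (K : Set B)) = ⊤) (w : G) :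
    ∑ J ∈ K.powerset, (-1 : ℂ) ^ J.card * ((Nat.card (P J) : ℂ)⁻¹ *
      ∑ x : G, if x⁻¹ * w * x ∈ P J then (1 : ℂ) else 0) = ε w := by
  have hspan := @rInv_le_span B G _ _ s K len P hmem hlen hmono hs
  have htop : ⊤ ≤ Submodule.span ℂ (Set.range (adB s K len P)) := by
    intro f _
    have h1 : f ∈ rInv (P ∅) := by
      intro x y hy
      rw [hP0, Subgroup.mem_bot] at hy
      rw [hy, mul_one]
    exact Submodule.span_mono (Set.image_subset_range _ _) (hspan (Finset.empty_subset _) h1)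
  let b : Module.Basis G ℂ (G → ℂ) :=
    basisOfTopLeSpanOfCardEqFinrank (adB s K len P) htop (by simp)
  have hb : ⇑b = adB s K len P := coe_basisOfTopLeSpanOfCardEqFinrank _ _ _
  have hrepr : ∀ J ⊆ K, ∀ f ∈ rInv (P J), ∀ x, ¬ J ⊆ ascS s K len x → b.repr f x = 0 := by
    intro J hJ f hf x hx
    have h1 := hspan hJ hf
    rw [← hb, b.mem_span_image] at h1
    by_contra h0
    exact hx (h1 (Finsupp.mem_support_iff.mpr h0))
  set m : G → ℂ := fun x => b.repr (fun z => adB s K len P x (w⁻¹ * z)) x with hm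
  have htr : ∀ J ∈ K.powerset, (Nat.card (P J) : ℂ)⁻¹ *
      (∑ x : G, if x⁻¹ * w * x ∈ P J then (1 : ℂ) else 0) =
      ∑ x : G, if J ⊆ ascS s K len x then m x else 0 := by
    intro J hJ
    rw [Finset.mem_powerset] at hJ
    rw [← trace_avT, LinearMap.trace_eq_matrix_trace ℂ b, Matrix.trace]
    refine Finset.sum_congr rfl fun x _ => ?_
    rw [Matrix.diag_apply, LinearMap.toMatrix_apply, hb]
    split_ifs with h
    · have hmm : adB s K len P x ∈ rInv (P J) := cosI_mem (hmono _ _ h) x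
      rw [avT_of_mem w hmm]
    · exact hrepr J hJ _ (avT_mem _ _ _) x h
  have step1 : ∑ J ∈ K.powerset, (-1 : ℂ) ^ J.card * ((Nat.card (P J) : ℂ)⁻¹ *
      ∑ x : G, if x⁻¹ * w * x ∈ P J then (1 : ℂ) else 0) =
      ∑ x : G, if ascS s K len x = ∅ then m x else 0 := by
    rw [Finset.sum_congr rfl fun J hJ => by rw [htr J hJ]]
    simp only [Finset.mul_sum]
    rw [Finset.sum_comm]
    refine Finset.sum_congr rfl fun x _ => ?_
    have hsub : (ascS s K len x).powerset = K.powerset.filter (· ⊆ ascS s K len x) := by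
      ext J
      simp only [Finset.mem_powerset, Finset.mem_filter]
      exact ⟨fun h => ⟨h.trans (Finset.filter_subset _ _), h⟩, fun h => h.2⟩
    have h2 : ∑ J ∈ K.powerset, (-1 : ℂ) ^ J.card * (if J ⊆ ascS s K len x then m x else 0) =
        (∑ J ∈ (ascS s K len x).powerset, (-1 : ℂ) ^ J.card) * m x := by
      rw [hsub, Finset.sum_filter, Finset.sum_mul]
      refine Finset.sum_congr rfl fun J _ => ?_
      split_ifs <;> simp
    rw [h2]
    have h3 := congrArg (Int.cast : ℤ → ℂ)
      (Finset.sum_powerset_neg_one_pow_card (x := ascS s K len x))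
    push_cast at h3
    rw [h3]
    split_ifs <;> simp
  rw [step1]
  -- the sign functional
  have hδ : ∀ x, ascS s K len x = ∅ → ∀ u, b.repr (Pi.single u 1) x =
      ε u * b.repr (Pi.single 1 1) x := by
    intro x hx
    have hst : ∀ u, ∀ i ∈ K, b.repr (Pi.single (u * s i) 1) x = - b.repr (Pi.single u 1) x := by
      intro u i hi
      have hsi : s i * s i = 1 := by
        rcases hP1 i hi _ (mul_mem (hmem {i} i (by simp)) (hmem {i} i (by simp))) with h | h
        · exact h
        · exfalso
          have h1 : s i = 1 := by simpa using h
          exact hs i hi 1 (by simp [h1])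
      have hin : (Pi.single (u * s i) 1 + Pi.single u 1 : G → ℂ) ∈ rInv (P {i}) := by
        intro z y hy
        rcases hP1 i hi y hy with rfl | rfl
        · simp
        · simp only [Pi.add_apply, Pi.single_apply]
          have e1 : z * s i = u ↔ z = u * s i := by
            constructor
            · rintro rfl; rw [mul_assoc, hsi, mul_one]
            · rintro rfl; rw [mul_assoc, hsi, mul_one]
          simp only [mul_left_inj, e1]
          ring
      have h0 := hrepr {i} (by simpa using hi) _ hin x (by rw [hx]; simp)
      rw [map_add, Finsupp.add_apply] at h0
      exact eq_neg_of_add_eq_zero_left h0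
    have hss : ∀ i ∈ K, ε (s i)⁻¹ = -1 := by
      intro i hi
      have h1 : ε (s i)⁻¹ * ε (s i) = 1 := by rw [← map_mul]; simp
      rw [hε i hi] at h1
      linear_combination -h1
    intro u
    have hu : u ∈ Subgroup.closure (s '' (K : Set B)) := by rw [hgen]; trivial
    induction hu using Subgroup.closure_induction_right with
    | one => simp
    | mul_right v _ y hy ih =>
      obtain ⟨i, hi, rfl⟩ := hy
      rw [hst v i hi, ih, map_mul, hε i hi]; ring
    | mul_inv_cancel v _ y hy ih =>
      obtain ⟨i, hi, rfl⟩ := hy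
      have := hst (v * (s i)⁻¹) i hi
      rw [inv_mul_cancel_right, ih] at this
      rw [map_mul, hss i hi]
      linear_combination this
  have hbs : ∀ x, ascS s K len x = ∅ → b x = Pi.single x 1 := by
    intro x hx
    rw [hb]
    funext z
    rw [adB, hx, hP0, cosI, Pi.single_apply]
    simp only [Subgroup.mem_bot, inv_mul_eq_one, eq_comm]
  have hself : ∀ x, ascS s K len x = ∅ → ε x * b.repr (Pi.single 1 1) x = 1 := by
    intro x hx
    rw [← hδ x hx, ← hbs x hx]; simp
  obtain ⟨x₀, hx₀⟩ := Finite.exists_max len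
  have hA0 : ascS s K len x₀ = ∅ := by
    refine Finset.filter_eq_empty_iff.mpr fun i _ => not_lt.mpr (hx₀ _)
  have huniq : ∀ x, ascS s K len x = ∅ → x = x₀ := by
    intro x hx
    by_contra hne
    have h1 : b.repr (Pi.single x₀ 1) x = 0 := by
      rw [← hbs x₀ hA0]; simp [Finsupp.single_apply, Ne.symm hne]
    rw [hδ x hx] at h1
    rcases mul_eq_zero.mp h1 with h | h
    · have := hself x₀ hA0; rw [h] at this; simp at this
    · have := hself x hx; rw [h] at this; simp at this
  rw [Finset.sum_eq_single x₀]
  · rw [if_pos hA0]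
    have h1 : (fun z => adB s K len P x₀ (w⁻¹ * z)) = Pi.single (w * x₀) 1 := by
      rw [← hb, hbs x₀ hA0]
      funext z
      simp only [Pi.single_apply, inv_mul_eq_iff_eq_mul]
    rw [hm]
    simp only
    rw [h1, hδ x₀ hA0, map_mul, mul_assoc, hself x₀ hA0, mul_one]
  · intro x _ hx
    rw [if_neg]
    exact fun h => hx (huniq x h)
  · simp

end Solomon
section Final

variable {B : Type*} [DecidableEq B] [Fintype B] {W : Type*} [Group W] [Fintype W]
  {M : CoxeterMatrix B} (cs : CoxeterSystem M W)

theorem sgn_liftable (M : CoxeterMatrix B) : M.IsLiftable (fun _ : B => (-1 : ℂ)) := by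
  intro i j; simp

/-- The sign character. -/
noncomputable def sgnW : W →* ℂ := cs.lift ⟨fun _ => (-1 : ℂ), sgn_liftable M⟩

theorem sgnW_simple (i : B) : sgnW cs (cs.simple i) = -1 :=
  cs.lift_apply_simple (sgn_liftable M) i

theorem sgnW_conj (x w : W) : sgnW cs (x⁻¹ * w * x) = sgnW cs w := by
  have h : sgnW cs x⁻¹ * sgnW cs x = 1 := by rw [← map_mul]; simp
  rw [map_mul, map_mul]
  linear_combination sgnW cs w * h

theorem parW_mono {J J' : Set B} (h : J ⊆ J') : parW cs J ≤ parW cs J' :=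
  Subgroup.closure_mono (Set.image_mono h)

theorem solomon_par (K : Finset B) (A : Subgroup W) (hA : A = parW cs (K : Set B)) (w : A) :
    ∑ J ∈ K.powerset, (-1 : ℂ) ^ J.card * ((Nat.card (parW cs (J : Set B)) : ℂ)⁻¹ *
      ∑ x : A,
        if (x : W)⁻¹ * (w : W) * (x : W) ∈ parW cs (J : Set B) then (1 : ℂ) else 0) =
      sgnW cs w := by
  have hsA : ∀ i ∈ K, cs.simple i ∈ A := fun i hi => by
    rw [hA]; exact Subgroup.subset_closure ⟨i, hi, rfl⟩
  let s : B → A := fun i => if h : i ∈ K then ⟨cs.simple i, hsA i h⟩ else 1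
  have hs : ∀ i ∈ K, (s i : W) = cs.simple i := by
    intro i hi; simp [s, hi]
  -- the parabolic subgroups inside `A`
  let P : Finset B → Subgroup A := fun J => (parW cs (J : Set B)).subgroupOf A
  have hmemP : ∀ J (y : A), y ∈ P J ↔ (y : W) ∈ parW cs (J : Set B) := fun J y =>
    Subgroup.mem_subgroupOf
  have := solomon (s := s) (K := K) (len := fun x : A => cs.length (x : W)) (P := P)
    ((sgnW cs).comp A.subtype)
    (fun i hi => by simp [hs i hi, sgnW_simple])
    (by
      intro J i hi
      rw [hmemP]
      by_cases h : i ∈ K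
      · rw [hs i h]; exact Subgroup.subset_closure ⟨i, hi, rfl⟩
      · simp [s, h, one_mem])
    (by
      intro J hJ x hx y hy hy1
      rw [hmemP] at hy
      have := length_lt_coset cs (J : Set B) (x := (x : W)) hy (by simpa using hy1)
        (fun i hi => by have := hx i hi; simpa [hs i (hJ hi)] using this)
      simpa using this)
    (by
      intro J J' h y hy
      rw [hmemP] at hy ⊢
      exact parW_mono cs (by exact_mod_cast h) hy)
    (by
      intro i hi x
      simp only [Subgroup.coe_mul, hs i hi]
      exact cs.length_mul_simple_ne _ _)
    (by
      ext y
      rw [hmemP]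
      simp [parW])
    (by
      intro i hi y hy
      rw [hmemP] at hy
      have hle : ∀ z ∈ parW cs (({i} : Finset B) : Set B), z = 1 ∨ z = cs.simple i := by
        intro z hz
        induction hz using Subgroup.closure_induction with
        | mem x hx => simp at hx; exact Or.inr hx
        | one => exact Or.inl rfl
        | mul a b _ _ ha hb =>
          rcases ha with rfl | rfl <;> rcases hb with rfl | rfl <;> simp
        | inv a _ ha =>
          rcases ha with rfl | rfl <;> simp
      rcases hle _ hy with h | h
      · exact Or.inl (by simpa using h)
      · exact Or.inr (Subtype.ext (by rw [h, hs i hi])))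
    (by
      have himg : A.subtype '' (s '' (K : Set B)) = cs.simple '' (K : Set B) := by
        rw [Set.image_image]
        exact Set.image_congr fun i hi => hs i hi
      apply Subgroup.map_injective A.subtype_injective
      rw [MonoidHom.map_closure, himg, ← MonoidHom.range_eq_map, Subgroup.range_subtype, hA]
      rfl)
    w
  rw [MonoidHom.comp_apply, Subgroup.coe_subtype] at this
  rw [← this]
  refine Finset.sum_congr rfl fun J hJ => ?_
  rw [Finset.mem_powerset] at hJ
  have hc : Nat.card (P J) = Nat.card (parW cs (J : Set B)) :=
    Nat.card_congr (Subgroup.subgroupOfEquivOfLe 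
      (hA ▸ parW_mono cs (by exact_mod_cast hJ))).toEquiv
  rw [hc]
  simp only [hmemP, Subgroup.coe_mul, Subgroup.coe_inv]

theorem dualCF_eq (K : Finset B) (A : Subgroup W)
    (hA : A = Subgroup.closure (cs.simple '' (K : Set B))) (f : W → ℂ)
    (hf : ∀ x ∈ A, ∀ w ∈ A, f (x⁻¹ * w * x) = f w) (w : W) (hw : w ∈ A) :
    dualCF cs A K f w = sgnW cs w * f w := by
  have h : ∑ J ∈ K.powerset, (-1 : ℂ) ^ J.card *
      ((Nat.card (Subgroup.closure (cs.simple '' (J : Set B))) : ℂ)⁻¹ *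
      ∑ x : A, if (x : W)⁻¹ * w * (x : W) ∈ Subgroup.closure (cs.simple '' (J : Set B))
        then (1 : ℂ) else 0) = sgnW cs w := solomon_par cs K A hA ⟨w, hw⟩
  rw [← h, Finset.sum_mul]
  simp only [dualCF, indCF]
  refine Finset.sum_congr rfl fun J _ => ?_
  rw [mul_assoc, mul_assoc, Finset.sum_mul]
  congr 2
  refine Finset.sum_congr rfl fun x _ => ?_
  rw [hf x x.2 w hw]
  by_cases hx : (x : W)⁻¹ * w * (x : W) ∈ Subgroup.closure (cs.simple '' (J : Set B))
  · rw [if_pos hx, if_pos hx, one_mul]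
  · rw [if_neg hx, if_neg hx, zero_mul]

end Final

/-- Induction from a standard parabolic subgroup `W_K` commutes with the duality operators:
`D_W (Ind_{W_K}^W h) = Ind_{W_K}^W (D_{W_K} h)` for every class function `h` on `W_K`. -/
theorem ind_dualCF_comm
    {B : Type*} [DecidableEq B] [Fintype B]
    {W : Type*} [Group W] [Fintype W]
    {M : CoxeterMatrix B} (cs : CoxeterSystem M W) (K : Finset B)
    (h : W → ℂ)
    (hh : ∀ x ∈ Subgroup.closure (cs.simple '' ↑K),
      ∀ w ∈ Subgroup.closure (cs.simple '' ↑K), h (x⁻¹ * w * x) = h w) :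
    dualCF cs ⊤ Finset.univ (indCF ⊤ (Subgroup.closure (cs.simple '' ↑K)) h) =
      indCF ⊤ (Subgroup.closure (cs.simple '' ↑K))
        (dualCF cs (Subgroup.closure (cs.simple '' ↑K)) K h) := by
  have hcl : ∀ x ∈ (⊤ : Subgroup W), ∀ w ∈ (⊤ : Subgroup W),
      indCF ⊤ (Subgroup.closure (cs.simple '' ↑K)) h (x⁻¹ * w * x) =
        indCF ⊤ (Subgroup.closure (cs.simple '' ↑K)) h w := by
    intro x hx w _
    simp only [indCF]
    congr 1
    refine Fintype.sum_equiv (Equiv.mulLeft (⟨x, hx⟩ : (⊤ : Subgroup W))) _ _ fun u => ?_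
    simp [mul_assoc]
  funext w
  rw [dualCF_eq cs Finset.univ ⊤ (by simp [cs.subgroup_closure_range_simple]) _ hcl w trivial]
  simp only [indCF]
  rw [mul_left_comm, Finset.mul_sum]
  congr 1
  refine Finset.sum_congr rfl fun x _ => ?_
  split_ifs with hx
  · rw [dualCF_eq cs K _ rfl h hh _ hx, sgnW_conj]
  · simp
end
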